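/- arXiv:1511.05456 — 3 statements merged into one kernel-verified Lean document; each statement's English description precedes it below -/
import Mathlib

section
/- For n ≥ 2, the number of corners in the set of symmetric tree-like tableaux of size 2n+1 equals 2^n · n! · (4n+13)/12. -/
open Finset

/-- `D` is a Young-diagram-shaped finite set of cells (cell `(i,j)` is in row `i`, column `j`,
indexed from the top-left corner `(0,0)`). -/
def IsYoung (D : Finset (ℕ × ℕ)) : Prop :=
  ∀ i j i' j', (i, j) ∈ D → i' ≤ i → j' ≤ j → (i', j') ∈ D

/-- `(D, P)` is a tree-like tableau: `D` is the Young-diagram shape and `P ⊆ D` is the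
set of pointed cells.  The top-left cell is pointed (root point); every non-root
point has a point above it in its column or a point to its left in its row, but not both;
every row and every column of `D` contains a point. -/
def IsTLT (D P : Finset (ℕ × ℕ)) : Prop :=
  IsYoung D ∧ P ⊆ D ∧ (0, 0) ∈ P ∧
  (∀ c ∈ P, c ≠ (0, 0) →
    ((∃ r < c.1, (r, c.2) ∈ P) ↔ ¬ (∃ k < c.2, (c.1, k) ∈ P))) ∧
  (∀ c ∈ D, (∃ k, (c.1, k) ∈ P) ∧ (∃ r, (r, c.2) ∈ P))

/-- A corner of the diagram `D`: a cell whose bottom and right edges are border edges. -/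
def CornerCell (D : Finset (ℕ × ℕ)) (c : ℕ × ℕ) : Prop :=
  c ∈ D ∧ (c.1 + 1, c.2) ∉ D ∧ (c.1, c.2 + 1) ∉ D


/-- `(D, P)` is symmetric: invariant under reflection across the main diagonal. -/
def IsSymmetric (D P : Finset (ℕ × ℕ)) : Prop :=
  (∀ i j, (i, j) ∈ D ↔ (j, i) ∈ D) ∧ (∀ i j, (i, j) ∈ P ↔ (j, i) ∈ P)

open scoped Classical in
/-- The (finite) set of symmetric tree-like tableaux of size `2n+1`; any such tableau
fits inside the `(2n+2) × (2n+2)` grid. -/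
noncomputable def SymTLTs (n : ℕ) : Finset (Finset (ℕ × ℕ) × Finset (ℕ × ℕ)) :=
  ((Finset.range (2 * n + 2) ×ˢ Finset.range (2 * n + 2)).powerset ×ˢ
      (Finset.range (2 * n + 2) ×ˢ Finset.range (2 * n + 2)).powerset).filter
    (fun T => IsTLT T.1 T.2 ∧ IsSymmetric T.1 T.2 ∧ T.2.card = 2 * n + 1)

open scoped Classical in
noncomputable def cornersOf (D : Finset (ℕ × ℕ)) : Finset (ℕ × ℕ) :=
  D.filter (CornerCell D)


/-! ### Words and sums over words -/

/-- All words of length `n` in the two letters `true` (vertical) and `false` (horizontal). -/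
def Wd : ℕ → Finset (List Bool)
  | 0 => {[]}
  | n + 1 => (Wd n).image (List.cons true) ∪ (Wd n).image (List.cons false)

lemma mem_Wd (n : ℕ) (w : List Bool) : w ∈ Wd n ↔ w.length = n := by
  induction n generalizing w with
  | zero => simp [Wd]
  | succ n ih =>
    simp only [Wd, mem_union, mem_image, ih]
    cases w with
    | nil => simp
    | cons x w => cases x <;> simp

/-- Sum over all words of length `n`. -/
def Sw (n : ℕ) (f : List Bool → ℕ) : ℕ := ∑ w ∈ Wd n, f w

lemma Sw_zero (f : List Bool → ℕ) : Sw 0 f = f [] := by simp [Sw, Wd]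

lemma Sw_succ (n : ℕ) (f : List Bool → ℕ) :
    Sw (n + 1) f = Sw n (fun w => f (true :: w)) + Sw n (fun w => f (false :: w)) := by
  unfold Sw
  rw [Wd, sum_union, sum_image, sum_image]
  · intro a _ b _ h; simpa using h
  · intro a _ b _ h; simpa using h
  · rw [Finset.disjoint_left]
    intro a h1 h2
    simp only [mem_image] at h1 h2
    obtain ⟨x, _, rfl⟩ := h1
    obtain ⟨y, _, h⟩ := h2
    simp at h

lemma Sw_add (n : ℕ) (f g : List Bool → ℕ) : Sw n (fun w => f w + g w) = Sw n f + Sw n g := by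
  simp [Sw, sum_add_distrib]

lemma Sw_mul (n c : ℕ) (f : List Bool → ℕ) : Sw n (fun w => c * f w) = c * Sw n f := by
  simp [Sw, mul_sum]

lemma Sw_split (a b : ℕ) (f : List Bool → ℕ) :
    Sw (a + b) f = Sw a (fun v => Sw b (fun u => f (v ++ u))) := by
  induction a generalizing f with
  | zero => simp [Sw_zero]
  | succ a ih =>
    rw [show a + 1 + b = (a + b) + 1 by ring, Sw_succ, Sw_succ, ih, ih]
    simp

lemma Sw_snoc (n : ℕ) (f : List Bool → ℕ) :
    Sw (n + 1) f = Sw n (fun w => f (w ++ [true])) + Sw n (fun w => f (w ++ [false])) := by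
  rw [Sw_split n 1, ← Sw_add]
  simp [Sw_succ, Sw_zero]

lemma Sw_one (f : List Bool → ℕ) : Sw 1 f = f [true] + f [false] := by
  simp [Sw_succ, Sw_zero]

/-- The sum over words with a horizontal letter at a fixed place. -/
def hS (f : List Bool → ℕ) (b a : ℕ) : ℕ := Sw b (fun v => Sw a (fun u => f (v ++ false :: u)))

/-- The commutation relation. -/
def CRel (f : List Bool → ℕ) : Prop := ∀ v u, f (v ++ true :: false :: u) =
  f (v ++ false :: true :: u) + f (v ++ false :: u) + f (v ++ true :: u)

lemma Sw_mid (f : List Bool → ℕ) (b a : ℕ) :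
    Sw (b + a + 1) f = Sw b (fun v => Sw a (fun u => f (v ++ true :: u))) +
      Sw b (fun v => Sw a (fun u => f (v ++ false :: u))) := by
  rw [show b + a + 1 = b + (a + 1) by ring, Sw_split, ← Sw_add]
  congr 1; funext v
  rw [Sw_succ]

lemma sVH (f : List Bool → ℕ) (hr : CRel f) (b a : ℕ) :
    Sw b (fun v => Sw a (fun u => f (v ++ true :: false :: u))) =
      Sw b (fun v => Sw a (fun u => f (v ++ false :: true :: u))) + Sw (b + a + 1) f := by
  rw [Sw_mid, ← Sw_add, ← Sw_add]
  congr 1; funext v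
  rw [← Sw_add, ← Sw_add]
  congr 1; funext u
  rw [hr]; ring

lemma hS_left (f : List Bool → ℕ) (b a : ℕ) :
    hS f (b + 1) a = Sw b (fun v => Sw a (fun u => f (v ++ true :: false :: u))) +
      Sw b (fun v => Sw a (fun u => f (v ++ false :: false :: u))) := by
  unfold hS
  rw [Sw_snoc]
  simp

lemma hS_right (f : List Bool → ℕ) (b a : ℕ) :
    hS f b (a + 1) = Sw b (fun v => Sw a (fun u => f (v ++ false :: true :: u))) +
      Sw b (fun v => Sw a (fun u => f (v ++ false :: false :: u))) := by
  unfold hS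
  rw [← Sw_add]
  congr 1; funext v
  rw [Sw_succ]

lemma hS_eq (f : List Bool → ℕ) (hr : CRel f) (h0 : ∀ w, f (false :: w) = f w) (b a : ℕ) :
    hS f b a = (b + 1) * Sw (b + a) f := by
  induction b generalizing a with
  | zero => simp [hS, Sw_zero, h0]
  | succ b ih =>
    have e := ih (a + 1)
    rw [hS_right] at e
    rw [hS_left, sVH f hr]
    rw [show b + 1 + a = b + a + 1 by ring]
    rw [show b + (a + 1) = b + a + 1 by ring] at e
    linarith

lemma hhS_eq (f : List Bool → ℕ) (hr : CRel f) (h0 : ∀ w, f (false :: w) = f w) (b a : ℕ) :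
    Sw b (fun v => Sw a (fun u => f (v ++ false :: false :: u))) =
      (b + 1) * ((b + 1) * Sw (b + a) f) := by
  have h := hS_eq (fun w => Sw a (fun t => f (w ++ false :: t))) ?_ ?_ b 0
  · rw [← hS_eq f hr h0 b a]
    simpa [hS, Sw_zero] using h
  · intro v u
    simp only
    rw [← Sw_add, ← Sw_add]
    congr 1; funext t
    have := hr v (u ++ false :: t)
    simpa using this
  · intro w
    simp [h0]

lemma Sw_step (f : List Bool → ℕ) (hr : CRel f) (h0 : ∀ w, f (false :: w) = f w)
    (h1 : ∀ v, f (v ++ [true]) = f (v ++ [false])) (n : ℕ) :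
    Sw (n + 1) f = 2 * (n + 1) * Sw n f := by
  have h := hS_eq f hr h0 n 0
  rw [Sw_snoc]
  simp only [hS, Sw_zero] at h
  simp only [h1]
  rw [h]; simp; ring

lemma Sw_fact (f : List Bool → ℕ) (hr : CRel f) (h0 : ∀ w, f (false :: w) = f w)
    (h1 : ∀ v, f (v ++ [true]) = f (v ++ [false])) (hn : f [] = 1) (n : ℕ) :
    Sw n f = 2 ^ n * n.factorial := by
  induction n with
  | zero => simp [Sw_zero, hn]
  | succ n ih => rw [Sw_step f hr h0 h1, ih, Nat.factorial_succ]; ring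

lemma VH_eq (f : List Bool → ℕ) (hr : CRel f) (h0 : ∀ w, f (false :: w) = f w) (b a : ℕ) :
    Sw b (fun v => Sw a (fun u => f (v ++ true :: false :: u))) + (b + 1) ^ 2 * Sw (b + a) f
      = (b + 2) * Sw (b + a + 1) f := by
  have h := hS_eq f hr h0 (b + 1) a
  rw [hS_left, hhS_eq f hr h0] at h
  rw [show b + 1 + a = b + a + 1 by ring] at h
  linarith

/-- Number of corners read off the word; the flag is the previous letter. -/
def cc : Bool → List Bool → ℕ
  | true, [] => 1
  | false, [] => 0
  | _, true :: w => cc true w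
  | true, false :: w => 2 + cc false w
  | false, false :: w => cc false w

lemma ccV (n : ℕ) (f : List Bool → ℕ) :
    Sw (n + 1) (fun w => f w * cc true w) =
      Sw (n + 1) (fun w => f w * cc false w) + 2 * Sw n (fun w => f (false :: w)) := by
  rw [Sw_succ, Sw_succ, ← Sw_mul]
  simp only [cc]
  simp only [mul_add, Sw_add, mul_comm 2]
  ring

lemma ccH (n : ℕ) (f : List Bool → ℕ) :
    Sw (n + 1) (fun w => f w * cc false w) =
      ∑ a ∈ range n, 2 * Sw a (fun v => Sw (n - 1 - a) (fun u => f (v ++ true :: false :: u)))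
       + Sw n (fun v => f (v ++ [true])) := by
  induction n generalizing f with
  | zero => simp [Sw_one, Sw_zero, cc]
  | succ n ih =>
    rw [Sw_succ]
    simp only [cc]
    rw [ccV n (fun w => f (true :: w)), ih (fun w => f (true :: w)), ih (fun w => f (false :: w)),
      sum_range_succ', Sw_succ n]
    simp only [Sw_zero, Sw_succ, mul_add, sum_add_distrib, List.nil_append, List.cons_append]
    have e : ∀ x, n + 1 - 1 - (x + 1) = n - 1 - x := by intro x; omega
    simp only [e]
    simp only [Nat.add_sub_cancel, Nat.sub_zero]
    ring

lemma total (f : List Bool → ℕ) (hr : CRel f) (h0 : ∀ w, f (false :: w) = f w)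
    (h1 : ∀ v, f (v ++ [true]) = f (v ++ [false])) (hn : f [] = 1) (m : ℕ) :
    12 * Sw (m + 2) (fun w => f w * cc true w) =
      2 ^ (m + 2) * (m + 2).factorial * (4 * (m + 2) + 13) := by
  have hF := Sw_fact f hr h0 h1 hn
  rw [ccV, ccH]
  simp only [h0]
  have h2 : 2 * Sw (m + 1) (fun v => f (v ++ [true])) = Sw (m + 2) f := by
    rw [Sw_snoc (m + 1) f]; simp only [h1]; ring
  rw [hF (m + 2)] at h2
  have key : ∀ k, k ≤ m + 1 → ((∑ a ∈ range k,
      2 * Sw a (fun v => Sw (m + 1 - 1 - a) (fun u => f (v ++ true :: false :: u))) : ℕ) : ℚ) =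
      2 ^ (m + 1) * (m + 1).factorial * (k * (k + 3)) -
      2 ^ m * m.factorial * (k * (k + 1) * (2 * k + 1) / 3) := by
    intro k
    induction k with
    | zero => simp
    | succ k ih =>
      intro hk
      have h := VH_eq f hr h0 k (m - k)
      rw [show k + (m - k) = m by omega, hF, hF] at h
      rw [sum_range_succ]
      push_cast
      have ih' := ih (by omega)
      push_cast at ih'
      rw [ih']
      have h' : ((Sw k (fun v => Sw (m - k) (fun u => f (v ++ true :: false :: u))) : ℕ) : ℚ) =
        (k + 2) * (2 ^ (m + 1) * (m + 1).factorial) - (k + 1) ^ 2 * (2 ^ m * m.factorial) := by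
        rw [eq_sub_iff_add_eq]; exact_mod_cast h
      rw [h']
      ring
  have hk := key (m + 1) le_rfl
  have h2' : (2 : ℚ) * (Sw (m + 1) (fun v => f (v ++ [true])) : ℕ) =
    2 ^ (m + 2) * (m + 2).factorial := by exact_mod_cast h2
  rw [← @Nat.cast_inj ℚ]
  have hF1 := hF (m + 1)
  have hF1' : ((Sw (m + 1) (fun w => f w) : ℕ) : ℚ) = 2 ^ (m + 1) * (m + 1).factorial := by
    exact_mod_cast hF1
  push_cast at hk ⊢
  rw [hk, hF1']
  have : ∀ x : ℚ, 12 * x = 6 * (2 * x) := by intro x; ring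
  rw [mul_add, mul_add, this ((Sw (m + 1) (fun v => f (v ++ [true])) : ℕ) : ℚ), h2']
  simp only [Nat.factorial_succ]
  push_cast
  ring

/-! ### Symmetric tableaux on a given shape -/

/-- Symmetric Young diagram containing the origin. -/
structure SY (D : Finset (ℕ × ℕ)) : Prop where
  young : ∀ i j i' j', (i, j) ∈ D → i' ≤ i → j' ≤ j → (i', j') ∈ D
  symm : ∀ i j, (i, j) ∈ D → (j, i) ∈ D
  zero : (0, 0) ∈ D

/-- Point sets of symmetric tree-like tableaux of shape `D`. -/
structure SP (D P : Finset (ℕ × ℕ)) : Prop where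
  sub : ∀ i j, (i, j) ∈ P → (i, j) ∈ D
  symm : ∀ i j, (i, j) ∈ P → (j, i) ∈ P
  zero : (0, 0) ∈ P
  tree : ∀ i j, (i, j) ∈ P → ¬ (i = 0 ∧ j = 0) →
    ((∃ r < i, (r, j) ∈ P) ↔ ¬ (∃ k < j, (i, k) ∈ P))
  row : ∀ i j, (i, j) ∈ D → ∃ k, (i, k) ∈ P

lemma sp_iff (D P : Finset (ℕ × ℕ)) : (IsTLT D P ∧ IsSymmetric D P) ↔ SY D ∧ SP D P := by
  constructor
  · rintro ⟨⟨h1, h2, h3, h4, h5⟩, h6, h7⟩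
    refine ⟨⟨h1, fun i j h => (h6 i j).1 h, h2 h3⟩, ⟨fun i j h => h2 h, fun i j h => (h7 i j).1 h,
      h3, fun i j h hn => h4 (i, j) h ?_, fun i j h => (h5 (i, j) h).1⟩⟩
    simpa using hn
  · rintro ⟨⟨h1, h2, h3⟩, ⟨g1, g2, g3, g4, g5⟩⟩
    refine ⟨⟨h1, fun c h => g1 c.1 c.2 h, g3, fun c h hn => g4 c.1 c.2 h ?_, fun c h => ⟨g5 c.1 c.2 h, ?_⟩⟩,
      fun i j => ⟨h2 i j, h2 j i⟩, fun i j => ⟨g2 i j, g2 j i⟩⟩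
    · intro hh; apply hn; ext <;> simp [hh]
    · obtain ⟨k, hk⟩ := g5 c.2 c.1 (h2 c.1 c.2 h)
      exact ⟨k, g2 _ _ hk⟩

open scoped Classical in
/-- The set of point sets. -/
noncomputable def PS (D : Finset (ℕ × ℕ)) : Finset (Finset (ℕ × ℕ)) := D.powerset.filter (SP D)

lemma mem_PS (D P : Finset (ℕ × ℕ)) : P ∈ PS D ↔ SP D P := by
  unfold PS
  simp only [mem_filter, mem_powerset, and_iff_right_iff_imp]
  exact fun h c hc => h.sub c.1 c.2 hc

/-- The increasing map omitting `k`. -/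
def sk (k a : ℕ) : ℕ := if a < k then a else a + 1

lemma sk_ne (k a : ℕ) : sk k a ≠ k := by unfold sk; split_ifs <;> omega
lemma sk_lt (k a b : ℕ) : sk k a < sk k b ↔ a < b := by unfold sk; split_ifs <;> omega
lemma sk_inj (k a b : ℕ) : sk k a = sk k b ↔ a = b := by unfold sk; split_ifs <;> omega
lemma sk_zero (k a : ℕ) (hk : 1 ≤ k) : sk k a = 0 ↔ a = 0 := by unfold sk; split_ifs <;> grind
lemma sk_surj (k a : ℕ) (h : a ≠ k) : ∃ b, sk k b = a := by
  by_cases h' : a < k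
  · exact ⟨a, by simp [sk, h']⟩
  · refine ⟨a - 1, ?_⟩
    unfold sk; split_ifs <;> omega

/-- `D'` is `D` with row and column `k` deleted. -/
def Del (k : ℕ) (D D' : Finset (ℕ × ℕ)) : Prop := ∀ a b, (a, b) ∈ D' ↔ (sk k a, sk k b) ∈ D

lemma sk_pair_injective (k : ℕ) : Function.Injective (fun c : ℕ × ℕ => (sk k c.1, sk k c.2)) := by
  intro c d h
  simp only [Prod.mk.injEq, sk_inj] at h
  exact Prod.ext h.1 h.2

/-- delete row and column `k`. -/
noncomputable def dl (k : ℕ) (P : Finset (ℕ × ℕ)) : Finset (ℕ × ℕ) :=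
  P.preimage (fun c : ℕ × ℕ => (sk k c.1, sk k c.2)) (sk_pair_injective k).injOn

lemma mem_dl (k : ℕ) (P : Finset (ℕ × ℕ)) (a b : ℕ) : (a, b) ∈ dl k P ↔ (sk k a, sk k b) ∈ P := by
  simp [dl]

/-- insert row and column `k` with points at `(k,l)` and `(l,k)`. -/
noncomputable def ins (k l : ℕ) (P : Finset (ℕ × ℕ)) : Finset (ℕ × ℕ) :=
  insert (k, l) (insert (l, k) (P.image (fun c : ℕ × ℕ => (sk k c.1, sk k c.2))))

lemma mem_ins (k l : ℕ) (P : Finset (ℕ × ℕ)) (a b : ℕ) : (a, b) ∈ ins k l P ↔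
    (a = k ∧ b = l) ∨ (a = l ∧ b = k) ∨ ∃ x y, (x, y) ∈ P ∧ sk k x = a ∧ sk k y = b := by
  simp [ins]

lemma corner_max {D : Finset (ℕ × ℕ)} (hD : SY D) {i j : ℕ} (hc : CornerCell D (i, j)) :
    (∀ r, (r, j) ∈ D → r ≤ i) ∧ (∀ r, (i, r) ∈ D → r ≤ j) := by
  obtain ⟨h1, h2, h3⟩ := hc
  constructor
  · intro r hr
    by_contra h
    exact h2 (hD.young _ _ _ _ hr (by simp; omega) le_rfl)
  · intro r hr
    by_contra h
    exact h3 (hD.young _ _ _ _ hr le_rfl (by simp; omega))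

lemma corner_symm {D : Finset (ℕ × ℕ)} (hD : SY D) {i j : ℕ} (hc : CornerCell D (i, j)) :
    CornerCell D (j, i) := by
  obtain ⟨h1, h2, h3⟩ := hc
  exact ⟨hD.symm _ _ h1, fun h => h3 (hD.symm _ _ h), fun h => h2 (hD.symm _ _ h)⟩

lemma sp_del {D D' P : Finset (ℕ × ℕ)} (hD : SY D) {k l : ℕ} (hkl : k ≠ l) (hk : 1 ≤ k)
    (hc : CornerCell D (k, l)) (hdel : Del k D D') (hP : SP D P)
    (hrow : ∀ x, (k, x) ∈ P ↔ x = l) : SP D' (dl k P) := by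
  obtain ⟨m1, m2⟩ := corner_max hD hc
  obtain ⟨m3, m4⟩ := corner_max hD (corner_symm hD hc)
  have hcol : ∀ x, (x, k) ∈ P ↔ x = l := fun x =>
    ⟨fun h => (hrow x).1 (hP.symm _ _ h), fun h => hP.symm _ _ ((hrow x).2 h)⟩
  have s0 : sk k 0 = 0 := (sk_zero k 0 hk).2 rfl
  refine ⟨?_, ?_, ?_, ?_, ?_⟩
  · intro i j h
    rw [mem_dl] at h
    rw [hdel]; exact hP.sub _ _ h
  · intro i j h
    rw [mem_dl] at h ⊢
    exact hP.symm _ _ h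
  · rw [mem_dl, s0]; exact hP.zero
  · intro i j h hn
    rw [mem_dl] at h
    have ht := hP.tree _ _ h (by rwa [sk_zero k i hk, sk_zero k j hk])
    have e1 : (∃ r < i, (r, j) ∈ dl k P) ↔ ∃ r < sk k i, (r, sk k j) ∈ P := by
      constructor
      · rintro ⟨r, hr, h'⟩
        exact ⟨sk k r, (sk_lt _ _ _).2 hr, (mem_dl _ _ _ _).1 h'⟩
      · rintro ⟨r, hr, h'⟩
        by_cases hrk : r = k
        · subst hrk
          have hj := (hrow _).1 h'
          have := m1 (sk r i) (hj ▸ hP.sub _ _ h)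
          omega
        · obtain ⟨r', rfl⟩ := sk_surj k r hrk
          exact ⟨r', (sk_lt _ _ _).1 hr, (mem_dl _ _ _ _).2 h'⟩
    have e2 : (∃ r < j, (i, r) ∈ dl k P) ↔ ∃ r < sk k j, (sk k i, r) ∈ P := by
      constructor
      · rintro ⟨r, hr, h'⟩
        exact ⟨sk k r, (sk_lt _ _ _).2 hr, (mem_dl _ _ _ _).1 h'⟩
      · rintro ⟨r, hr, h'⟩
        by_cases hrk : r = k
        · subst hrk
          have hj := (hcol _).1 h'
          have := m4 (sk r j) (hj ▸ hP.sub _ _ h)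
          omega
        · obtain ⟨r', rfl⟩ := sk_surj k r hrk
          exact ⟨r', (sk_lt _ _ _).1 hr, (mem_dl _ _ _ _).2 h'⟩
    rw [e1, e2]; exact ht
  · intro i j h
    rw [hdel] at h
    obtain ⟨x, hx⟩ := hP.row _ _ h
    have : ∃ x, x ≠ k ∧ (sk k i, x) ∈ P := by
      by_cases hxk : x = k
      · subst hxk
        have hl := (hcol _).1 hx
        have ht := hP.tree _ _ hx (by omega)
        have : ¬ ∃ r < sk x i, (r, x) ∈ P := by
          rintro ⟨r, hr, h'⟩
          have := (hcol _).1 h'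
          omega
        rw [ht, not_not] at this
        obtain ⟨y, hy, h'⟩ := this
        exact ⟨y, by omega, h'⟩
      · exact ⟨x, hxk, hx⟩
    obtain ⟨x, hxk, hx⟩ := this
    obtain ⟨x', rfl⟩ := sk_surj k x hxk
    exact ⟨x', (mem_dl _ _ _ _).2 hx⟩

lemma ins_row {k l : ℕ} (hkl : k ≠ l) (Q : Finset (ℕ × ℕ)) (x : ℕ) :
    (k, x) ∈ ins k l Q ↔ x = l := by
  rw [mem_ins]
  constructor
  · rintro (h | h | ⟨a, b, _, h, _⟩)
    · exact h.2
    · omega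
    · exact absurd h (sk_ne _ _)
  · rintro rfl; simp

lemma ins_col {k l : ℕ} (hkl : k ≠ l) (Q : Finset (ℕ × ℕ)) (x : ℕ) :
    (x, k) ∈ ins k l Q ↔ x = l := by
  rw [mem_ins]
  constructor
  · rintro (h | h | ⟨a, b, _, _, h⟩)
    · omega
    · exact h.1
    · exact absurd h (sk_ne _ _)
  · rintro rfl; simp

lemma ins_sk (k l : ℕ) (Q : Finset (ℕ × ℕ)) (a b : ℕ) :
    (sk k a, sk k b) ∈ ins k l Q ↔ (a, b) ∈ Q := by
  rw [mem_ins]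
  constructor
  · rintro (h | h | ⟨x, y, h, h1, h2⟩)
    · exact absurd h.1 (sk_ne _ _)
    · exact absurd h.2 (sk_ne _ _)
    · rw [sk_inj] at h1 h2; subst h1 h2; exact h
  · intro h; exact Or.inr (Or.inr ⟨a, b, h, rfl, rfl⟩)

lemma sp_ins {D D' Q : Finset (ℕ × ℕ)} (hD : SY D) {k l : ℕ} (hkl : k ≠ l) (hk : 1 ≤ k)
    (hc : CornerCell D (k, l)) (hdel : Del k D D') (hQ : SP D' Q) : SP D (ins k l Q) := by
  obtain ⟨m1, m2⟩ := corner_max hD hc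
  obtain ⟨m3, m4⟩ := corner_max hD (corner_symm hD hc)
  have hrow := ins_row hkl Q
  have hcol := ins_col hkl Q
  have s0 : sk k 0 = 0 := (sk_zero k 0 hk).2 rfl
  have hkD : (k, l) ∈ D := hc.1
  have sub : ∀ i j, (i, j) ∈ ins k l Q → (i, j) ∈ D := by
    intro i j h
    rw [mem_ins] at h
    rcases h with ⟨rfl, rfl⟩ | ⟨rfl, rfl⟩ | ⟨x, y, h, rfl, rfl⟩
    · exact hkD
    · exact hD.symm _ _ hkD
    · exact (hdel _ _).1 (hQ.sub _ _ h)
  have symm : ∀ i j, (i, j) ∈ ins k l Q → (j, i) ∈ ins k l Q := by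
    intro i j h
    rw [mem_ins] at h ⊢
    rcases h with ⟨rfl, rfl⟩ | ⟨rfl, rfl⟩ | ⟨x, y, h, rfl, rfl⟩
    · simp
    · simp
    · exact Or.inr (Or.inr ⟨y, x, hQ.symm _ _ h, rfl, rfl⟩)
  -- row `l` of the new tableau has another point
  have hlrow : ∃ x, x ≠ k ∧ (l, x) ∈ ins k l Q := by
    obtain ⟨l', hl'⟩ := sk_surj k l hkl.symm
    have : (l', 0) ∈ D' := by
      rw [hdel, s0, hl']
      exact hD.young _ _ _ _ (hD.symm _ _ hkD) le_rfl (Nat.zero_le _)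
    obtain ⟨x, hx⟩ := hQ.row _ _ this
    refine ⟨sk k x, sk_ne _ _, ?_⟩
    rw [← hl', ins_sk]; exact hx
  obtain ⟨z, hzk, hz⟩ := hlrow
  have hzlt : z < k := by have := m4 z (sub _ _ hz); omega
  refine ⟨sub, symm, ?_, ?_, ?_⟩
  · rw [← s0, ins_sk]; exact hQ.zero
  · intro i j h hn
    by_cases hik : i = k
    · subst hik
      have := (hrow _).1 h
      subst this
      constructor
      · rintro _ ⟨y, hy, h'⟩
        have := (hrow _).1 h'
        omega
      · intro _
        exact ⟨z, hzlt, symm _ _ hz⟩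
    by_cases hjk : j = k
    · subst hjk
      have := (hcol _).1 h
      subst this
      constructor
      · rintro ⟨y, hy, h'⟩
        have := (hcol _).1 h'
        omega
      · intro hh
        exact absurd ⟨z, hzlt, hz⟩ hh
    obtain ⟨a, rfl⟩ := sk_surj k i hik
    obtain ⟨b, rfl⟩ := sk_surj k j hjk
    have hab := (ins_sk _ _ _ _ _).1 h
    have ht := hQ.tree a b hab (by rwa [sk_zero k a hk, sk_zero k b hk] at hn)
    have e1 : (∃ r < a, (r, b) ∈ Q) ↔ ∃ r < sk k a, (r, sk k b) ∈ ins k l Q := by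
      constructor
      · rintro ⟨r, hr, h'⟩
        exact ⟨sk k r, (sk_lt _ _ _).2 hr, (ins_sk _ _ _ _ _).2 h'⟩
      · rintro ⟨r, hr, h'⟩
        by_cases hrk : r = k
        · subst hrk
          have hj := (hrow _).1 h'
          have := m1 (sk r a) (hj ▸ sub _ _ h)
          omega
        · obtain ⟨r', rfl⟩ := sk_surj k r hrk
          exact ⟨r', (sk_lt _ _ _).1 hr, (ins_sk _ _ _ _ _).1 h'⟩
    have e2 : (∃ r < b, (a, r) ∈ Q) ↔ ∃ r < sk k b, (sk k a, r) ∈ ins k l Q := by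
      constructor
      · rintro ⟨r, hr, h'⟩
        exact ⟨sk k r, (sk_lt _ _ _).2 hr, (ins_sk _ _ _ _ _).2 h'⟩
      · rintro ⟨r, hr, h'⟩
        by_cases hrk : r = k
        · subst hrk
          have hj := (hcol _).1 h'
          have := m4 (sk r b) (hj ▸ sub _ _ h)
          omega
        · obtain ⟨r', rfl⟩ := sk_surj k r hrk
          exact ⟨r', (sk_lt _ _ _).1 hr, (ins_sk _ _ _ _ _).1 h'⟩
    rw [← e1, ← e2]; exact ht
  · intro i j h
    by_cases hik : i = k
    · subst hik
      exact ⟨l, (hrow _).2 rfl⟩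
    obtain ⟨a, rfl⟩ := sk_surj k i hik
    have : (a, 0) ∈ D' := by
      rw [hdel, s0]
      exact hD.young _ _ _ _ h le_rfl (Nat.zero_le _)
    obtain ⟨x, hx⟩ := hQ.row _ _ this
    exact ⟨sk k x, (ins_sk _ _ _ _ _).2 hx⟩

open scoped Classical in
lemma card_del {D D' : Finset (ℕ × ℕ)} (hD : SY D) {k l : ℕ} (hkl : k ≠ l) (hk : 1 ≤ k)
    (hc : CornerCell D (k, l)) (hdel : Del k D D') :
    ((PS D).filter (fun P => ∀ x, (k, x) ∈ P ↔ x = l)).card = (PS D').card := by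
  refine Finset.card_nbij' (dl k) (ins k l) ?_ ?_ ?_ ?_
  · intro P hP
    simp only [coe_filter, Set.mem_ofPred_eq, mem_PS, mem_coe] at hP ⊢
    exact sp_del hD hkl hk hc hdel hP.1 hP.2
  · intro Q hQ
    simp only [coe_filter, Set.mem_ofPred_eq, mem_PS, mem_coe] at hQ ⊢
    exact ⟨sp_ins hD hkl hk hc hdel hQ, ins_row hkl Q⟩
  · intro P hP
    simp only [coe_filter, Set.mem_ofPred_eq, mem_PS] at hP
    obtain ⟨hP, hrow⟩ := hP
    ext ⟨a, b⟩
    by_cases ha : a = k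
    · subst ha; rw [ins_row hkl, hrow]
    by_cases hb : b = k
    · subst hb; rw [ins_col hkl, ← hrow]
      exact ⟨hP.symm _ _, hP.symm _ _⟩
    obtain ⟨a, rfl⟩ := sk_surj k a ha
    obtain ⟨b, rfl⟩ := sk_surj k b hb
    rw [ins_sk, mem_dl]
  · intro Q hQ
    ext ⟨a, b⟩
    rw [mem_dl, ins_sk]

open scoped Classical in
lemma card_rem {D D' : Finset (ℕ × ℕ)} (hD : SY D) {i j : ℕ} (hi : 1 ≤ i) (hj : 1 ≤ j)
    (hD' : ∀ a b, (a, b) ∈ D' ↔ (a, b) ∈ D ∧ ¬ (a = i ∧ b = j) ∧ ¬ (a = j ∧ b = i)) :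
    ((PS D).filter (fun P => (i, j) ∉ P)).card = (PS D').card := by
  congr 1
  ext P
  simp only [mem_filter, mem_PS]
  constructor
  · rintro ⟨hP, hn⟩
    refine ⟨?_, hP.symm, hP.zero, hP.tree, ?_⟩
    · intro a b h
      rw [hD']
      refine ⟨hP.sub _ _ h, ?_, ?_⟩
      · rintro ⟨rfl, rfl⟩; exact hn h
      · rintro ⟨rfl, rfl⟩; exact hn (hP.symm _ _ h)
    · intro a b h
      exact hP.row a b ((hD' _ _).1 h).1
  · intro hP
    refine ⟨⟨?_, hP.symm, hP.zero, hP.tree, ?_⟩, ?_⟩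
    · intro a b h
      exact ((hD' _ _).1 (hP.sub _ _ h)).1
    · intro a b h
      apply hP.row a 0
      rw [hD']
      exact ⟨hD.young _ _ _ _ h le_rfl (Nat.zero_le _), by omega, by omega⟩
    · intro h
      exact ((hD' _ _).1 (hP.sub _ _ h)).2.1 ⟨rfl, rfl⟩

/-- Main recurrence at an off-diagonal corner. -/
lemma PS_corner {D D1 D2 D3 : Finset (ℕ × ℕ)} (hD : SY D) {i j : ℕ} (hi : 1 ≤ i) (hj : 1 ≤ j)
    (hij : i ≠ j) (hc : CornerCell D (i, j))
    (hD1 : ∀ a b, (a, b) ∈ D1 ↔ (a, b) ∈ D ∧ ¬ (a = i ∧ b = j) ∧ ¬ (a = j ∧ b = i))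
    (hD2 : Del i D D2) (hD3 : Del j D D3) :
    (PS D).card = (PS D1).card + (PS D2).card + (PS D3).card := by
  classical
  obtain ⟨m1, m2⟩ := corner_max hD hc
  rw [← card_rem hD hi hj hD1, ← card_del hD hij hi hc hD2,
    ← card_del hD hij.symm hj (corner_symm hD hc) hD3]
  rw [← card_union_of_disjoint, ← card_union_of_disjoint]
  · congr 1
    ext P
    simp only [mem_union, mem_filter, mem_PS, ← and_or_left]
    refine ⟨fun hP => ⟨hP, ?_⟩, fun h => h.1⟩
    by_cases hp : (i, j) ∈ P
    swap
    · exact Or.inl (Or.inl hp)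
    have ht := hP.tree _ _ hp (by omega)
    by_cases hl : ∃ k < j, (i, k) ∈ P
    · right
      have hno : ¬ ∃ r < i, (r, j) ∈ P := fun h => ht.1 h hl
      intro x
      constructor
      · intro h
        have h' := hP.symm _ _ h
        have := m1 _ (hP.sub _ _ h')
        by_contra hx
        exact hno ⟨x, by omega, h'⟩
      · rintro rfl; exact hP.symm _ _ hp
    · left; right
      intro x
      constructor
      · intro h
        have := m2 _ (hP.sub _ _ h)
        by_contra hx
        exact hl ⟨x, by omega, h⟩
      · rintro rfl; exact hp
  · rw [Finset.disjoint_left]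
    intro P h1 h2
    simp only [mem_union, mem_filter, mem_PS] at h1 h2
    obtain ⟨hP, h2⟩ := h2
    have hji := (h2 i).2 rfl
    have hp := hP.symm _ _ hji
    rcases h1 with h1 | h1
    · exact h1.2 hp
    · have ht := hP.tree _ _ hp (by omega)
      have a1 : ¬ ∃ k < j, (i, k) ∈ P := by
        rintro ⟨k, hk, h⟩
        have := (h1.2 k).1 h
        omega
      have a2 : ¬ ∃ r < i, (r, j) ∈ P := by
        rintro ⟨k, hk, h⟩
        have := (h2 k).1 (hP.symm _ _ h)
        omega
      exact a2 (ht.2 a1)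
  · rw [Finset.disjoint_left]
    intro P h1 h2
    simp only [mem_filter] at h1 h2
    exact h1.2 ((h2.2 j).2 rfl)

lemma sp_diag {D P : Finset (ℕ × ℕ)} (hP : SP D P) (i : ℕ) (hi : 1 ≤ i) : (i, i) ∉ P := by
  intro h
  have ht := hP.tree _ _ h (by omega)
  have e : (∃ r < i, (r, i) ∈ P) ↔ (∃ r < i, (i, r) ∈ P) :=
    ⟨fun ⟨r, hr, h⟩ => ⟨r, hr, hP.symm _ _ h⟩, fun ⟨r, hr, h⟩ => ⟨r, hr, hP.symm _ _ h⟩⟩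
  rw [e] at ht
  exact iff_not_self ht

lemma PS_diag {D D1 : Finset (ℕ × ℕ)} (hD : SY D) {i : ℕ} (hi : 1 ≤ i)
    (hD1 : ∀ a b, (a, b) ∈ D1 ↔ (a, b) ∈ D ∧ ¬ (a = i ∧ b = i)) :
    (PS D).card = (PS D1).card := by
  classical
  rw [← card_rem hD hi hi (D' := D1)]
  · congr 1
    ext P
    simp only [mem_filter, mem_PS]
    exact ⟨fun h => ⟨h, sp_diag h i hi⟩, fun h => h.1⟩
  · intro a b; rw [hD1]; tauto

lemma PS_top {D D1 : Finset (ℕ × ℕ)} (hD : SY D) {m : ℕ} (hm : 1 ≤ m)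
    (hc : CornerCell D (m, 0)) (hD1 : Del m D D1) :
    (PS D).card = (PS D1).card := by
  classical
  rw [← card_del hD (by omega) hm hc hD1]
  congr 1
  ext P
  simp only [mem_filter, mem_PS]
  refine ⟨fun h => ⟨h, ?_⟩, fun h => h.1⟩
  obtain ⟨m1, m2⟩ := corner_max hD hc
  obtain ⟨k, hk⟩ := h.row m 0 hc.1
  have hk0 := m2 k (h.sub _ _ hk)
  intro x
  constructor
  · intro hx; have := m2 x (h.sub _ _ hx); omega
  · rintro rfl
    have : k = 0 := by omega
    rwa [this] at hk

/-- Point count. -/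
lemma sp_card {D P : Finset (ℕ × ℕ)} (hD : SY D) (hP : SP D P) (m : ℕ)
    (hm : ∀ x, (0, x) ∈ D ↔ x ≤ m) : P.card = 2 * m + 1 := by
  classical
  have hm' : ∀ x, (x, 0) ∈ D ↔ x ≤ m := fun x =>
    ⟨fun h => (hm x).1 (hD.symm _ _ h), fun h => hD.symm _ _ ((hm x).2 h)⟩
  -- points without a point to the left, other than the root
  set A := P.filter (fun c => c ≠ (0, 0) ∧ ¬ ∃ k < c.2, (c.1, k) ∈ P) with hA
  set B := P.filter (fun c => c ≠ (0, 0) ∧ ¬ ∃ k < c.1, (k, c.2) ∈ P) with hB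
  have hAB : B.card = A.card := by
    refine Finset.card_nbij' Prod.swap Prod.swap ?_ ?_ ?_ ?_
    · rintro ⟨a, b⟩ h
      simp only [hA, hB, coe_filter, Set.mem_ofPred_eq, Prod.swap, ne_eq, Prod.mk.injEq] at h ⊢
      refine ⟨hP.symm _ _ h.1, by tauto, ?_⟩
      rintro ⟨k, hk, h'⟩
      exact h.2.2 ⟨k, hk, hP.symm _ _ h'⟩
    · rintro ⟨a, b⟩ h
      simp only [hA, hB, coe_filter, Set.mem_ofPred_eq, Prod.swap, ne_eq, Prod.mk.injEq] at h ⊢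
      refine ⟨hP.symm _ _ h.1, by tauto, ?_⟩
      rintro ⟨k, hk, h'⟩
      exact h.2.2 ⟨k, hk, hP.symm _ _ h'⟩
    · intro c _; simp
    · intro c _; simp
  have hcardA : A.card = (Finset.Icc 1 m).card := by
    refine Finset.card_nbij Prod.fst ?_ ?_ ?_
    · rintro ⟨a, b⟩ h
      simp only [hA, mem_coe, mem_filter, coe_Icc, Set.mem_Icc, ne_eq, Prod.mk.injEq] at h ⊢
      obtain ⟨h1, h2, h3⟩ := h
      constructor
      · by_contra h0
        have ha : a = 0 := by omega
        subst ha
        exact h3 ⟨0, by omega, hP.zero⟩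
      · rw [← hm']
        exact hD.young _ _ _ _ (hP.sub _ _ h1) le_rfl (Nat.zero_le _)
    · rintro ⟨a, b⟩ h ⟨a', b'⟩ h' e
      simp only [hA, coe_filter, Set.mem_ofPred_eq] at h h' e
      subst e
      obtain ⟨h1, h2, h3⟩ := h
      obtain ⟨h1', h2', h3'⟩ := h'
      have : b = b' := by
        rcases lt_trichotomy b b' with hb | hb | hb
        · exact absurd ⟨b, hb, h1⟩ h3'
        · exact hb
        · exact absurd ⟨b', hb, h1'⟩ h3
      rw [this]
    · intro a ha
      simp only [coe_Icc, Set.mem_Icc] at ha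
      have hex := hP.row a 0 ((hm' a).2 ha.2)
      refine ⟨(a, Nat.find hex), ?_, rfl⟩
      simp only [hA, coe_filter, Set.mem_ofPred_eq, ne_eq, Prod.mk.injEq]
      refine ⟨Nat.find_spec hex, by omega, ?_⟩
      rintro ⟨k, hk, h⟩
      exact Nat.find_min hex hk h
  have hP' : P = insert (0, 0) (A ∪ B) := by
    ext ⟨a, b⟩
    simp only [mem_insert, mem_union, hA, hB, mem_filter]
    constructor
    · intro h
      by_cases h0 : (a, b) = (0, 0)
      · exact Or.inl h0
      · right
        have ht := hP.tree a b h (by simpa using h0)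
        by_cases hl : ∃ k < b, (a, k) ∈ P
        · right; exact ⟨h, h0, fun h' => ht.1 h' hl⟩
        · left; exact ⟨h, h0, hl⟩
    · rintro (h | h | h)
      · rw [h]; exact hP.zero
      · exact h.1
      · exact h.1
  have hdisj : Disjoint A B := by
    rw [Finset.disjoint_left]
    rintro ⟨a, b⟩ h1 h2
    simp only [hA, hB, mem_filter] at h1 h2
    have ht := hP.tree a b h1.1 (by simpa using h1.2.1)
    exact h2.2.2 (ht.2 h1.2.2)
  have h00 : (0, 0) ∉ A ∪ B := by simp [hA, hB]
  rw [hP', card_insert_of_notMem h00, card_union_of_disjoint hdisj, hAB, hcardA]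
  simp; ring

/-! ### Shapes from words -/

/-- The symmetric diagram whose half-border (read from the top right towards the diagonal, omitting
the first vertical edge) is the given word. -/
def shp : List Bool → Finset (ℕ × ℕ)
  | [] => {(0, 0)}
  | false :: w => insert (0, w.length + 1) (insert (w.length + 1, 0) (shp w))
  | true :: w => (range (w.length + 2) ×ˢ range (w.length + 2)).filter
      (fun p => p.1 = 0 ∨ p.2 = 0 ∨ (p.1 - 1, p.2 - 1) ∈ shp w)

lemma mem_nil (a b : ℕ) : (a, b) ∈ shp [] ↔ a = 0 ∧ b = 0 := by simp [shp]

lemma mem_H (w : List Bool) (a b : ℕ) : (a, b) ∈ shp (false :: w) ↔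
    (a = 0 ∧ b = w.length + 1) ∨ (a = w.length + 1 ∧ b = 0) ∨ (a, b) ∈ shp w := by
  simp [shp]

lemma mem_V (w : List Bool) (a b : ℕ) : (a, b) ∈ shp (true :: w) ↔
    (a ≤ w.length + 1 ∧ b ≤ w.length + 1) ∧
      (a = 0 ∨ b = 0 ∨ (a - 1, b - 1) ∈ shp w) := by
  simp [shp, Nat.lt_succ_iff]

lemma shp_bd (w : List Bool) (a b : ℕ) (h : (a, b) ∈ shp w) : a ≤ w.length ∧ b ≤ w.length := by
  induction w generalizing a b with
  | nil => rw [mem_nil] at h; simp [h]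
  | cons x w ih =>
    cases x
    · rw [mem_H] at h
      simp only [List.length_cons]
      rcases h with h | h | h
      · omega
      · omega
      · have := ih _ _ h; omega
    · rw [mem_V] at h
      simpa using h.1

lemma mem_V0 (w : List Bool) (b : ℕ) : (0, b) ∈ shp (true :: w) ↔ b ≤ w.length + 1 := by
  rw [mem_V]; simp

lemma mem_V0' (w : List Bool) (b : ℕ) : (b, 0) ∈ shp (true :: w) ↔ b ≤ w.length + 1 := by
  rw [mem_V]; simp

lemma mem_VS (w : List Bool) (a b : ℕ) : (a + 1, b + 1) ∈ shp (true :: w) ↔ (a, b) ∈ shp w := by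
  rw [mem_V]
  simp only [Nat.add_sub_cancel]
  constructor
  · rintro ⟨_, h | h | h⟩
    · omega
    · omega
    · exact h
  · intro h
    have := shp_bd _ _ _ h
    exact ⟨by omega, Or.inr (Or.inr h)⟩

lemma shp_row0 (w : List Bool) (x : ℕ) : (0, x) ∈ shp w ↔ x ≤ w.length := by
  induction w with
  | nil => rw [mem_nil]; simp
  | cons y w ih =>
    cases y
    · rw [mem_H, ih]; simp only [List.length_cons]; grind
    · rw [mem_V0]; simp

lemma shp_SY (w : List Bool) : SY (shp w) := by
  induction w with
  | nil =>
    constructor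
    · intro i j i' j' h h1 h2
      rw [mem_nil] at h ⊢; omega
    · intro i j h
      rw [mem_nil] at h ⊢; omega
    · rw [mem_nil]; simp
  | cons x w ih =>
    have hz : (0, 0) ∈ shp (x :: w) := by rw [shp_row0]; simp
    cases x
    · refine ⟨?_, ?_, hz⟩
      · intro i j i' j' h h1 h2
        have r0 := shp_row0 w
        rw [mem_H] at h ⊢
        rcases h with h | h | h
        · by_cases e : j' = w.length + 1
          · omega
          · right; right
            have : i' = 0 := by omega
            subst this
            rw [r0]; omega
        · by_cases e : i' = w.length + 1
          · omega
          · right; right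
            have : j' = 0 := by omega
            subst this
            apply ih.symm
            rw [r0]; omega
        · exact Or.inr (Or.inr (ih.young _ _ _ _ h h1 h2))
      · intro i j h
        rw [mem_H] at h ⊢
        rcases h with h | h | h
        · omega
        · omega
        · exact Or.inr (Or.inr (ih.symm _ _ h))
    · refine ⟨?_, ?_, hz⟩
      · intro i j i' j' h h1 h2
        have hb := shp_bd _ _ _ h
        simp only [List.length_cons] at hb
        cases i' with
        | zero => rw [mem_V0]; omega
        | succ i' =>
          cases j' with
          | zero => rw [mem_V0']; omega
          | succ j' =>
            obtain ⟨i, rfl⟩ : ∃ k, i = k + 1 := ⟨i - 1, by omega⟩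
            obtain ⟨j, rfl⟩ : ∃ k, j = k + 1 := ⟨j - 1, by omega⟩
            rw [mem_VS] at h ⊢
            exact ih.young _ _ _ _ h (by omega) (by omega)
      · intro i j h
        rw [mem_V] at h ⊢
        obtain ⟨h1, h2⟩ := h
        refine ⟨by omega, ?_⟩
        rcases h2 with h | h | h
        · omega
        · omega
        · exact Or.inr (Or.inr (ih.symm _ _ h))

lemma corner_V (w : List Bool) (i j : ℕ) :
    CornerCell (shp (true :: w)) (i + 1, j + 1) ↔ CornerCell (shp w) (i, j) := by
  unfold CornerCell
  simp only [mem_VS]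

lemma corner_H (w : List Bool) (i j : ℕ) (hi : 1 ≤ i) (hj : 1 ≤ j) :
    CornerCell (shp (false :: w)) (i, j) ↔ CornerCell (shp w) (i, j) := by
  have h : ∀ a b, 1 ≤ a → 1 ≤ b → ((a, b) ∈ shp (false :: w) ↔ (a, b) ∈ shp w) := by
    intro a b ha hb
    rw [mem_H]
    constructor
    · rintro (h | h | h)
      · omega
      · omega
      · exact h
    · exact fun h => Or.inr (Or.inr h)
  unfold CornerCell
  simp only
  rw [h i j hi hj, h (i + 1) j (by omega) hj, h i (j + 1) hi (by omega)]

lemma Del_V (w w' : List Bool) (k : ℕ) (hl : w.length = w'.length + 1) (hk : k ≤ w.length)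
    (h : Del k (shp w) (shp w')) : Del (k + 1) (shp (true :: w)) (shp (true :: w')) := by
  have e : ∀ a, sk (k + 1) (a + 1) = sk k a + 1 := by
    intro a; unfold sk; split_ifs <;> omega
  have e0 : sk (k + 1) 0 = 0 := by simp [sk]
  have el : ∀ a, sk (k + 1) a ≤ w.length + 1 ↔ a ≤ w'.length + 1 := by
    intro a; unfold sk; split_ifs <;> omega
  intro a b
  cases a with
  | zero => rw [e0, mem_V0, mem_V0, el]
  | succ a =>
    cases b with
    | zero => rw [e0, mem_V0', mem_V0', el]
    | succ b => rw [e, e, mem_VS, mem_VS, h]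

lemma Del_H (w w' : List Bool) (k : ℕ) (hl : w.length = w'.length + 1) (hk : k ≤ w.length)
    (hk1 : 1 ≤ k) (h : Del k (shp w) (shp w')) :
    Del k (shp (false :: w)) (shp (false :: w')) := by
  have el : ∀ a, sk k a = w.length + 1 ↔ a = w'.length + 1 := by
    intro a; unfold sk; split_ifs <;> omega
  intro a b
  rw [mem_H, mem_H, h, el, el, sk_zero k a hk1, sk_zero k b hk1]

lemma shp_corner (v u : List Bool) : ∃ i j, 1 ≤ i ∧ 1 ≤ j ∧ i ≠ j ∧
    CornerCell (shp (v ++ true :: false :: u)) (i, j) ∧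
    (∀ a b, (a, b) ∈ shp (v ++ false :: true :: u) ↔
      (a, b) ∈ shp (v ++ true :: false :: u) ∧ ¬ (a = i ∧ b = j) ∧ ¬ (a = j ∧ b = i)) ∧
    Del i (shp (v ++ true :: false :: u)) (shp (v ++ false :: u)) ∧
    Del j (shp (v ++ true :: false :: u)) (shp (v ++ true :: u)) := by
  induction v with
  | nil =>
    have r0 := shp_row0 u
    have c0 : ∀ x, (x, 0) ∈ shp u ↔ x ≤ u.length := fun x =>
      ⟨fun h => (r0 x).1 ((shp_SY u).symm _ _ h), fun h => (shp_SY u).symm _ _ ((r0 x).2 h)⟩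
    have bd := shp_bd u
    refine ⟨1, u.length + 2, le_rfl, by omega, by omega, ?_, ?_, ?_, ?_⟩
    · simp only [List.nil_append]
      rw [show (1, u.length + 2) = (0 + 1, u.length + 1 + 1) from rfl, corner_V]
      refine ⟨?_, ?_, ?_⟩
      · rw [shp_row0]; simp
      · simp only; rw [mem_H]
        rintro (h | h | h)
        · omega
        · omega
        · have := bd _ _ h; omega
      · simp only; rw [shp_row0]; simp
    · intro a b
      simp only [List.nil_append]
      cases a with
      | zero => rw [shp_row0, shp_row0]; simp
      | succ a =>
        cases b with
        | zero => rw [mem_H, mem_V0', mem_V0']; simp; omega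
        | succ b =>
          rw [mem_H, mem_VS, mem_VS, mem_H]
          have := bd a b
          simp only [List.length_cons]
          constructor
          · rintro (h | h | h)
            · omega
            · omega
            · have := bd _ _ h
              exact ⟨Or.inr (Or.inr h), by omega, by omega⟩
          · rintro ⟨h | h | h, h1, h2⟩
            · omega
            · omega
            · exact Or.inr (Or.inr h)
    · intro a b
      simp only [List.nil_append]
      cases a with
      | zero =>
        rw [show sk 1 0 = 0 from rfl, shp_row0, mem_V0]
        simp only [List.length_cons]
        unfold sk; split_ifs <;> omega
      | succ a =>
        rw [show sk 1 (a + 1) = a + 1 + 1 by simp [sk]]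
        cases b with
        | zero =>
          rw [show sk 1 0 = 0 from rfl, mem_H, mem_V0', c0]
          simp only [List.length_cons]; grind
        | succ b =>
          rw [show sk 1 (b + 1) = b + 1 + 1 by simp [sk], mem_VS]
    · have e := Del_V (false :: u) u (u.length + 1) (by simp) (by simp) ?_
      · simpa using e
      · intro a b
        rw [mem_H]
        have el : ∀ a, sk (u.length + 1) a ≠ u.length + 1 := fun a => sk_ne _ _
        simp only [el, and_false, false_and, false_or]
        constructor
        · intro h
          have := bd _ _ h
          rwa [sk, if_pos (by omega), sk, if_pos (by omega)]
        · intro h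
          have := bd _ _ h
          unfold sk at this h
          split_ifs at this h
          · exact h
          all_goals omega
  | cons x v ih =>
    obtain ⟨i, j, hi, hj, hij, hc, h1, h2, h3⟩ := ih
    have hb := shp_bd _ _ _ hc.1
    have l1 : (v ++ true :: false :: u).length = (v ++ false :: u).length + 1 := by simp; omega
    have l2 : (v ++ true :: false :: u).length = (v ++ true :: u).length + 1 := by simp; omega
    have l3 : (v ++ false :: true :: u).length = (v ++ true :: false :: u).length := by simp
    cases x
    · refine ⟨i, j, hi, hj, hij, ?_, ?_, ?_, ?_⟩
      · exact (corner_H _ _ _ hi hj).2 hc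
      · intro a b
        simp only [List.cons_append]
        rw [mem_H, mem_H, h1, l3]
        grind
      · exact Del_H _ _ _ l1 hb.1 hi h2
      · exact Del_H _ _ _ l2 hb.2 hj h3
    · refine ⟨i + 1, j + 1, by omega, by omega, by omega, ?_, ?_, ?_, ?_⟩
      · exact (corner_V _ _ _).2 hc
      · intro a b
        simp only [List.cons_append]
        cases a with
        | zero => rw [mem_V0, mem_V0, l3]; omega
        | succ a =>
          cases b with
          | zero => rw [mem_V0', mem_V0', l3]; omega
          | succ b =>
            rw [mem_VS, mem_VS, h1]; grind
      · exact Del_V _ _ _ l1 hb.1 h2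
      · exact Del_V _ _ _ l2 hb.2 h3

lemma shp_diag (v : List Bool) : ∃ i, 1 ≤ i ∧
    (∀ a b, (a, b) ∈ shp (v ++ [false]) ↔
      (a, b) ∈ shp (v ++ [true]) ∧ ¬ (a = i ∧ b = i)) := by
  induction v with
  | nil =>
    refine ⟨1, le_rfl, ?_⟩
    intro a b
    simp only [List.nil_append]
    rw [mem_H, mem_V, mem_nil, mem_nil]
    simp only [List.length_nil]
    omega
  | cons x v ih =>
    obtain ⟨i, hi, h⟩ := ih
    have l3 : (v ++ [false]).length = (v ++ [true]).length := by simp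
    cases x
    · refine ⟨i, hi, ?_⟩
      intro a b
      simp only [List.cons_append]
      rw [mem_H, mem_H, h, l3]
      grind
    · refine ⟨i + 1, by omega, ?_⟩
      intro a b
      simp only [List.cons_append]
      cases a with
      | zero => rw [mem_V0, mem_V0, l3]; omega
      | succ a =>
        cases b with
        | zero => rw [mem_V0', mem_V0', l3]; omega
        | succ b =>
          rw [mem_VS, mem_VS, h]; grind

/-- Number of symmetric tableaux with a given border word. -/
noncomputable def fw (w : List Bool) : ℕ := (PS (shp w)).card

lemma fw_rel : CRel fw := by
  intro v u
  obtain ⟨i, j, hi, hj, hij, hc, h1, h2, h3⟩ := shp_corner v u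
  exact PS_corner (shp_SY _) hi hj hij hc h1 h2 h3

lemma fw_diag (v : List Bool) : fw (v ++ [true]) = fw (v ++ [false]) := by
  obtain ⟨i, hi, h⟩ := shp_diag v
  exact PS_diag (shp_SY _) hi h

lemma fw_H (w : List Bool) : fw (false :: w) = fw w := by
  have bd := shp_bd w
  refine PS_top (shp_SY _) (m := w.length + 1) (by omega) ⟨?_, ?_, ?_⟩ ?_
  · rw [mem_H]; omega
  · intro h; have := shp_bd _ _ _ h; simp at this
  · simp only; rw [mem_H]
    rintro (h | h | h)
    · omega
    · omega
    · have := bd _ _ h; omega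
  · intro a b
    rw [mem_H]
    have el : ∀ a, sk (w.length + 1) a ≠ w.length + 1 := fun a => sk_ne _ _
    simp only [el, and_false, false_and, false_or]
    constructor
    · intro h
      have := bd _ _ h
      rwa [sk, if_pos (by omega), sk, if_pos (by omega)]
    · intro h
      have := bd _ _ h
      unfold sk at this h
      split_ifs at this h
      · exact h
      all_goals omega

lemma fw_nil : fw [] = 1 := by
  unfold fw
  rw [card_eq_one]
  refine ⟨{(0, 0)}, ?_⟩
  ext P
  rw [mem_PS, mem_singleton]
  constructor
  · intro h
    ext ⟨a, b⟩
    rw [mem_singleton]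
    constructor
    · intro hp
      simpa using (mem_nil _ _).1 (h.sub _ _ hp)
    · intro hp; rw [hp]; exact h.zero
  · rintro rfl
    refine ⟨?_, ?_, ?_, ?_, ?_⟩
    · intro i j h; simpa [mem_nil] using h
    · intro i j h; simp at h ⊢; tauto
    · simp
    · intro i j h hn; simp at h; tauto
    · intro i j h
      rw [mem_nil] at h
      exact ⟨0, by simp [h.1]⟩

open scoped Classical in
lemma corners_card (w : List Bool) : (cornersOf (shp w)).card = cc true w ∧
    ((cornersOf (shp w)).filter (fun c => 1 ≤ c.1 ∧ 1 ≤ c.2)).card = cc false w := by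
  have mc : ∀ w c, c ∈ cornersOf (shp w) ↔ CornerCell (shp w) c := by
    intro w c
    unfold cornersOf
    rw [mem_filter]
    exact ⟨fun h => h.2, fun h => ⟨h.1, h⟩⟩
  induction w with
  | nil =>
    have : cornersOf (shp []) = {(0, 0)} := by
      ext ⟨a, b⟩
      rw [mc]
      unfold CornerCell
      simp only [mem_nil]
      simp
    rw [this]
    simp [cc, Finset.filter_singleton]
  | cons x w ih =>
    obtain ⟨ih1, ih2⟩ := ih
    cases x
    · have e2 : (cornersOf (shp (false :: w))).filter (fun c => 1 ≤ c.1 ∧ 1 ≤ c.2) =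
          (cornersOf (shp w)).filter (fun c => 1 ≤ c.1 ∧ 1 ≤ c.2) := by
        ext ⟨a, b⟩
        simp only [mem_filter, mc]
        constructor
        · rintro ⟨h, h1, h2⟩
          exact ⟨(corner_H _ _ _ h1 h2).1 h, h1, h2⟩
        · rintro ⟨h, h1, h2⟩
          exact ⟨(corner_H _ _ _ h1 h2).2 h, h1, h2⟩
      have ca : CornerCell (shp (false :: w)) (0, w.length + 1) := by
        refine ⟨?_, ?_, ?_⟩
        · rw [mem_H]; omega
        · simp only; rw [mem_H]
          rintro (h | h | h)
          · omega
          · omega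
          · have := shp_bd _ _ _ h; omega
        · intro h; have := shp_bd _ _ _ h; simp at this
      have cb := corner_symm (shp_SY _) ca
      have e1 : cornersOf (shp (false :: w)) = insert (0, w.length + 1) (insert (w.length + 1, 0)
          ((cornersOf (shp w)).filter (fun c => 1 ≤ c.1 ∧ 1 ≤ c.2))) := by
        rw [← e2]
        ext ⟨a, b⟩
        simp only [mem_insert, mem_filter, mc, Prod.mk.injEq]
        constructor
        · intro h
          by_cases ha : a = 0
          · subst ha
            left
            refine ⟨rfl, ?_⟩
            have h1 := (corner_max (shp_SY _) h).2 _ ca.1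
            have h2 := (corner_max (shp_SY _) ca).2 _ h.1
            omega
          · by_cases hb : b = 0
            · subst hb
              right; left
              refine ⟨?_, rfl⟩
              have h1 := (corner_max (shp_SY _) h).1 _ cb.1
              have h2 := (corner_max (shp_SY _) cb).1 _ h.1
              omega
            · exact Or.inr (Or.inr ⟨h, by omega, by omega⟩)
        · rintro (⟨rfl, rfl⟩ | ⟨rfl, rfl⟩ | h)
          · exact ca
          · exact cb
          · exact h.1
      refine ⟨?_, ?_⟩
      · rw [e1, card_insert_of_notMem, card_insert_of_notMem, ih2]
        · simp [cc]; omega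
        · simp
        · simp
      · rw [e2, ih2]; simp [cc]
    · have hpos : ∀ c, CornerCell (shp (true :: w)) c → 1 ≤ c.1 ∧ 1 ≤ c.2 := by
        rintro ⟨a, b⟩ ⟨h1, h2, h3⟩
        have hb := shp_bd _ _ _ h1
        simp only [List.length_cons] at hb h2 h3 ⊢
        constructor
        · by_contra h0
          have ha : a = 0 := by omega
          subst ha
          have hbb : w.length < b := by
            by_contra hh; apply h3; rw [mem_V0]; omega
          obtain ⟨b, rfl⟩ : ∃ k, b = k + 1 := ⟨b - 1, by omega⟩
          apply h2
          rw [mem_VS, shp_row0]; omega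
        · by_contra h0
          have ha : b = 0 := by omega
          subst ha
          have hbb : w.length < a := by
            by_contra hh; apply h2; rw [mem_V0']; omega
          obtain ⟨a, rfl⟩ : ∃ k, a = k + 1 := ⟨a - 1, by omega⟩
          apply h3
          rw [mem_VS]
          apply (shp_SY w).symm
          rw [shp_row0]; omega
      have e2 : (cornersOf (shp (true :: w))).filter (fun c => 1 ≤ c.1 ∧ 1 ≤ c.2) =
          cornersOf (shp (true :: w)) := by
        rw [filter_eq_self]
        intro c hc
        exact hpos c ((mc _ _).1 hc)
      have e1 : cornersOf (shp (true :: w)) =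
          (cornersOf (shp w)).image (fun c => (c.1 + 1, c.2 + 1)) := by
        ext ⟨a, b⟩
        simp only [mem_image, mc, Prod.exists, Prod.mk.injEq]
        constructor
        · intro h
          have hp := hpos _ h
          simp only at hp
          obtain ⟨a, rfl⟩ : ∃ k, a = k + 1 := ⟨a - 1, by omega⟩
          obtain ⟨b, rfl⟩ : ∃ k, b = k + 1 := ⟨b - 1, by omega⟩
          exact ⟨a, b, (corner_V _ _ _).1 h, rfl, rfl⟩
        · rintro ⟨x, y, h, rfl, rfl⟩
          exact (corner_V _ _ _).2 h
      have e3 : (cornersOf (shp (true :: w))).card = cc true w := by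
        rw [e1, card_image_of_injective, ih1]
        rintro ⟨a, b⟩ ⟨c, d⟩ h
        simpa using h
      rw [e2, e3]
      simp [cc]

lemma shp_surj (m : ℕ) (D : Finset (ℕ × ℕ)) (hD : SY D) (hm : ∀ x, (0, x) ∈ D ↔ x ≤ m) :
    ∃ w : List Bool, w.length = m ∧ shp w = D := by
  induction m generalizing D with
  | zero =>
    refine ⟨[], rfl, ?_⟩
    ext ⟨a, b⟩
    rw [mem_nil]
    constructor
    · rintro ⟨rfl, rfl⟩; exact hD.zero
    · intro h
      have h1 := (hm b).1 (hD.young _ _ _ _ h (Nat.zero_le _) le_rfl)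
      have h2 := (hm a).1 (hD.young _ _ _ _ (hD.symm _ _ h) (Nat.zero_le _) le_rfl)
      omega
  | succ m ih =>
    have bd : ∀ a b, (a, b) ∈ D → a ≤ m + 1 ∧ b ≤ m + 1 := by
      intro a b h
      have h1 := (hm b).1 (hD.young _ _ _ _ h (Nat.zero_le _) le_rfl)
      have h2 := (hm a).1 (hD.young _ _ _ _ (hD.symm _ _ h) (Nat.zero_le _) le_rfl)
      omega
    by_cases hv : (1, m + 1) ∈ D
    · have hinj : Function.Injective (fun c : ℕ × ℕ => (c.1 + 1, c.2 + 1)) := by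
        rintro ⟨a, b⟩ ⟨c, d⟩ h; simpa using h
      set D' := D.preimage (fun c : ℕ × ℕ => (c.1 + 1, c.2 + 1)) hinj.injOn with hD'
      have mem' : ∀ a b, (a, b) ∈ D' ↔ (a + 1, b + 1) ∈ D := by
        intro a b; rw [hD', Finset.mem_preimage]
      have hex := ih D' ⟨?_, ?_, ?_⟩ ?_
      · obtain ⟨w, hw, hs⟩ := hex
        refine ⟨true :: w, by simp [hw], ?_⟩
        ext ⟨a, b⟩
        cases a with
        | zero => rw [mem_V0, hw, hm]
        | succ a =>
          cases b with
          | zero =>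
            rw [mem_V0', hw, ← hm]
            exact ⟨hD.symm _ _, hD.symm _ _⟩
          | succ b => rw [mem_VS, hs, mem']
      · intro i j i' j' h h1 h2
        rw [mem'] at h ⊢
        exact hD.young _ _ _ _ h (by omega) (by omega)
      · intro i j h
        rw [mem'] at h ⊢
        exact hD.symm _ _ h
      · rw [mem']
        exact hD.young _ _ _ _ hv (by omega) (by omega)
      · intro x
        rw [mem']
        constructor
        · intro h; have := bd _ _ h; omega
        · intro h; exact hD.young _ _ _ _ hv (by omega) (by omega)
    · set D' := D.filter (fun c => c ≠ (0, m + 1) ∧ c ≠ (m + 1, 0)) with hD'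
      have hv' : ∀ a b, (a, b) ∈ D → 1 ≤ a → b ≤ m := by
        intro a b h ha
        by_contra hb
        exact hv (hD.young _ _ _ _ h ha (by omega))
      have mem' : ∀ a b, (a, b) ∈ D' ↔ (a, b) ∈ D ∧ a ≤ m ∧ b ≤ m := by
        intro a b
        simp only [hD', mem_filter, ne_eq, Prod.mk.injEq]
        refine and_congr_right fun h => ?_
        have h1 := bd _ _ h
        have h2 := hv' _ _ h
        have h3 := hv' _ _ (hD.symm _ _ h)
        omega
      have hex := ih D' ⟨?_, ?_, ?_⟩ ?_
      · obtain ⟨w, hw, hs⟩ := hex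
        refine ⟨false :: w, by simp [hw], ?_⟩
        ext ⟨a, b⟩
        rw [mem_H, hs, mem', hw]
        constructor
        · rintro (⟨rfl, rfl⟩ | ⟨rfl, rfl⟩ | h)
          · rw [hm]
          · apply hD.symm; rw [hm]
          · exact h.1
        · intro h
          have h1 := bd _ _ h
          have h2 := hv' _ _ h
          have h3 := hv' _ _ (hD.symm _ _ h)
          by_cases ha : a ≤ m ∧ b ≤ m
          · exact Or.inr (Or.inr ⟨h, ha⟩)
          · omega
      · intro i j i' j' h h1 h2
        rw [mem'] at h ⊢
        exact ⟨hD.young _ _ _ _ h.1 (by omega) (by omega), by omega, by omega⟩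
      · intro i j h
        rw [mem'] at h ⊢
        exact ⟨hD.symm _ _ h.1, h.2.2, h.2.1⟩
      · rw [mem']
        exact ⟨hD.zero, by omega, by omega⟩
      · intro x
        rw [mem', hm]; omega

lemma shp_inj (w w' : List Bool) (hl : w.length = w'.length) (h : shp w = shp w') : w = w' := by
  induction w generalizing w' with
  | nil => cases w' with
    | nil => rfl
    | cons y w' => simp at hl
  | cons x w ih =>
    cases w' with
    | nil => simp at hl
    | cons y w' =>
      have hl' : w.length = w'.length := by simpa using hl
      have hV : ∀ u : List Bool, (1, u.length + 1) ∈ shp (true :: u) := by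
        intro u
        rw [show (1, u.length + 1) = (0 + 1, u.length + 1) from rfl, mem_VS, shp_row0]
      have hH : ∀ u : List Bool, (1, u.length + 1) ∉ shp (false :: u) := by
        intro u hu
        rw [mem_H] at hu
        rcases hu with hu | hu | hu
        · omega
        · omega
        · have := shp_bd _ _ _ hu; omega
      cases x <;> cases y
      · rw [ih w' hl']
        ext ⟨a, b⟩
        have hab : (a, b) ∈ shp (false :: w) ↔ (a, b) ∈ shp (false :: w') := by rw [h]
        rw [mem_H, mem_H, hl'] at hab
        constructor
        · intro hh
          have := shp_bd _ _ _ hh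
          have := hab.1 (Or.inr (Or.inr hh))
          rcases this with h1 | h1 | h1
          · omega
          · omega
          · exact h1
        · intro hh
          have := shp_bd _ _ _ hh
          have := hab.2 (Or.inr (Or.inr hh))
          rcases this with h1 | h1 | h1
          · omega
          · omega
          · exact h1
      · have h1 := hV w'
        rw [← h, ← hl'] at h1
        exact absurd h1 (hH w)
      · have h1 := hV w
        rw [h, hl'] at h1
        exact absurd h1 (hH w')
      · rw [ih w' hl']
        ext ⟨a, b⟩
        rw [← mem_VS, h, mem_VS]

lemma row0_exists (D : Finset (ℕ × ℕ)) (hD : SY D) : ∃ m, ∀ x, (0, x) ∈ D ↔ x ≤ m := by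
  classical
  have hne : (D.filter (fun c => c.1 = 0)).Nonempty := ⟨(0, 0), by simp [hD.zero]⟩
  obtain ⟨⟨a, m⟩, hc, hmax⟩ := exists_max_image (D.filter (fun c => c.1 = 0)) Prod.snd hne
  simp only [mem_filter] at hc hmax
  obtain ⟨h1, rfl⟩ := hc
  refine ⟨m, fun x => ⟨fun h => ?_, fun h => hD.young _ _ _ _ h1 le_rfl h⟩⟩
  exact hmax (0, x) ⟨h, rfl⟩

open scoped Classical in
lemma sum_eq (n : ℕ) : ∑ T ∈ SymTLTs n, (cornersOf T.1).card =
    Sw n (fun w => fw w * cc true w) := by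
  have mS : ∀ T, T ∈ SymTLTs n ↔ ∃ w ∈ Wd n, T.1 = shp w ∧ T.2 ∈ PS (shp w) := by
    rintro ⟨D, P⟩
    simp only [SymTLTs, mem_filter, mem_product, mem_powerset]
    rw [← and_assoc (a := IsTLT D P), sp_iff]
    constructor
    · rintro ⟨_, ⟨hD, hP⟩, hc⟩
      obtain ⟨m, hm⟩ := row0_exists D hD
      have := sp_card hD hP m hm
      obtain ⟨w, hw, hs⟩ := shp_surj m D hD hm
      refine ⟨w, ?_, hs.symm, ?_⟩
      · rw [mem_Wd]; omega
      · rw [mem_PS, hs]; exact hP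
    · rintro ⟨w, hw, rfl, hP⟩
      rw [mem_PS] at hP
      rw [mem_Wd] at hw
      have hsub : shp w ⊆ range (2 * n + 2) ×ˢ range (2 * n + 2) := by
        rintro ⟨a, b⟩ h
        have := shp_bd _ _ _ h
        simp only [mem_product, mem_range]; omega
      refine ⟨⟨hsub, ?_⟩, ⟨shp_SY w, hP⟩, ?_⟩
      · rintro ⟨a, b⟩ h
        exact hsub (hP.sub _ _ h)
      · rw [sp_card (shp_SY w) hP w.length (shp_row0 w), hw]
  have hU : SymTLTs n = (Wd n).biUnion (fun w => (PS (shp w)).image (fun P => (shp w, P))) := by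
    ext ⟨D, P⟩
    rw [mS]
    simp only [mem_biUnion, mem_image, Prod.mk.injEq]
    constructor
    · rintro ⟨w, hw, h1, h2⟩
      exact ⟨w, hw, P, h2, h1.symm, rfl⟩
    · rintro ⟨w, hw, Q, h2, h1, rfl⟩
      exact ⟨w, hw, h1.symm, h2⟩
  rw [hU, sum_biUnion]
  · unfold Sw
    refine sum_congr rfl fun w _ => ?_
    rw [sum_image (by intro a _ b _ h; simpa using h)]
    simp only [sum_const, smul_eq_mul, (corners_card w).1]
    rfl
  · intro w hw w' hw' hne
    simp only [Function.onFun]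
    rw [Finset.disjoint_left]
    rintro ⟨D, P⟩ h1 h2
    simp only [mem_image, Prod.mk.injEq] at h1 h2
    obtain ⟨_, _, h1, _⟩ := h1
    obtain ⟨_, _, h2, _⟩ := h2
    apply hne
    rw [mem_coe, mem_Wd] at hw hw'
    exact shp_inj w w' (by omega) (h1.trans h2.symm)

open scoped Classical in
theorem stmt8 (n : ℕ) (hn : 2 ≤ n) :
    12 * ∑ T ∈ SymTLTs n, (cornersOf T.1).card
    = 2 ^ n * n.factorial * (4 * n + 13) := by
  obtain ⟨m, rfl⟩ : ∃ m, n = m + 2 := ⟨n - 2, by omega⟩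
  rw [sum_eq]
  exact total fw fw_rel fw_H fw_diag fw_nil m
end

section
/- For n ≥ 2, the number of non-occupied corners in the set of symmetric tree-like tableaux of size 2n+1 equals 2^n·n!·(4n+13)/12 − 2^n·n!. -/
open Finset

open scoped Classical in
/-- Non-occupied corners of a tableau `(D, P)`. -/
noncomputable def nocCornersOf (D P : Finset (ℕ × ℕ)) : Finset (ℕ × ℕ) :=
  D.filter (fun c => CornerCell D c ∧ c ∉ P)


/-! ### Abstract tableaux on a set of labels -/

/-- The order of rows (and columns) attached to a half-word `S`. -/
def Prec (S : Finset ℕ) (i j : ℕ) : Prop :=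
  (i ∈ S ∧ (j ∈ S → i < j)) ∨ (i ∉ S ∧ j ∉ S ∧ j < i)

/-- The cells of the shape attached to a half-word `S`. -/
def Cel (S : Finset ℕ) (i j : ℕ) : Prop :=
  (i ≤ j ∧ i ∈ S) ∨ (j ≤ i ∧ j ∈ S)

/-- Symmetric tableaux over a label set `V`. -/
structure Tab (V : Finset ℕ) (lt cell : ℕ → ℕ → Prop) (P : Finset (ℕ × ℕ)) : Prop where
  sub : ∀ i j, (i, j) ∈ P → i ∈ V ∧ j ∈ V ∧ cell i j
  symm : ∀ i j, (i, j) ∈ P → (j, i) ∈ P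
  root : (0, 0) ∈ P
  cond : ∀ i j, (i, j) ∈ P → ¬ (i = 0 ∧ j = 0) →
    ((∃ r, lt r i ∧ (r, j) ∈ P) ↔ ¬ (∃ k, lt k j ∧ (i, k) ∈ P))
  cov : ∀ i ∈ V, ∃ j, (i, j) ∈ P

/-- Renumbering of a set of points. -/
def pullP (V' : Finset ℕ) (g : ℕ → ℕ) (P : Finset (ℕ × ℕ)) : Finset (ℕ × ℕ) :=
  (V' ×ˢ V').filter fun c => (g c.1, g c.2) ∈ P

theorem mem_pullP {V' : Finset ℕ} {g : ℕ → ℕ} {P : Finset (ℕ × ℕ)} {i j : ℕ} :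
    (i, j) ∈ pullP V' g P ↔ i ∈ V' ∧ j ∈ V' ∧ (g i, g j) ∈ P := by
  simp [pullP, and_assoc]

theorem Tab.pullP {V V' : Finset ℕ} {lt lt' cell cell' : ℕ → ℕ → Prop} {P : Finset (ℕ × ℕ)}
    {f g : ℕ → ℕ} (h : Tab V lt cell P)
    (hg : ∀ i ∈ V', g i ∈ V ∧ f (g i) = i) (hf : ∀ i ∈ V, f i ∈ V' ∧ g (f i) = i)
    (h0 : g 0 = 0) (h0' : 0 ∈ V')
    (hlt : ∀ i ∈ V', ∀ j ∈ V', (lt' i j ↔ lt (g i) (g j)))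
    (hcell : ∀ i ∈ V', ∀ j ∈ V', (g i, g j) ∈ P → cell' i j) :
    Tab V' lt' cell' (pullP V' g P) := by
  have key : ∀ r, r ∈ V → ∃ s ∈ V', g s = r := fun r hr => ⟨f r, hf r hr⟩
  constructor
  · intro i j hij
    rw [mem_pullP] at hij
    exact ⟨hij.1, hij.2.1, hcell i hij.1 j hij.2.1 hij.2.2⟩
  · intro i j hij
    rw [mem_pullP] at hij ⊢
    exact ⟨hij.2.1, hij.1, h.symm _ _ hij.2.2⟩
  · rw [mem_pullP, h0]
    exact ⟨h0', h0', h.root⟩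
  · intro i j hij hne
    rw [mem_pullP] at hij
    obtain ⟨hi, hj, hP⟩ := hij
    have hf0 : f 0 = 0 := by
      have h3 := (hg 0 h0').2
      rwa [h0] at h3
    have hne' : ¬ (g i = 0 ∧ g j = 0) := by
      rintro ⟨h1, h2⟩
      apply hne
      constructor
      · rw [← (hg i hi).2, h1]; exact hf0
      · rw [← (hg j hj).2, h2]; exact hf0
    have e1 : (∃ r, lt' r i ∧ (r, j) ∈ _root_.pullP V' g P) ↔
        (∃ r, lt r (g i) ∧ (r, g j) ∈ P) := by
      constructor
      · rintro ⟨r, h1, h2⟩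
        rw [mem_pullP] at h2
        exact ⟨g r, (hlt r h2.1 i hi).1 h1, h2.2.2⟩
      · rintro ⟨r, h1, h2⟩
        obtain ⟨s, hs, rfl⟩ := key r (h.sub _ _ h2).1
        exact ⟨s, (hlt s hs i hi).2 h1, mem_pullP.2 ⟨hs, hj, h2⟩⟩
    have e2 : (∃ r, lt' r j ∧ (i, r) ∈ _root_.pullP V' g P) ↔
        (∃ r, lt r (g j) ∧ (g i, r) ∈ P) := by
      constructor
      · rintro ⟨r, h1, h2⟩
        rw [mem_pullP] at h2
        exact ⟨g r, (hlt r h2.2.1 j hj).1 h1, h2.2.2⟩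
      · rintro ⟨r, h1, h2⟩
        obtain ⟨s, hs, rfl⟩ := key r (h.sub _ _ h2).2.1
        exact ⟨s, (hlt s hs j hj).2 h1, mem_pullP.2 ⟨hi, hs, h2⟩⟩
    rw [e1, e2]
    exact h.cond _ _ hP hne'
  · intro i hi
    obtain ⟨j, hj⟩ := h.cov (g i) (hg i hi).1
    obtain ⟨s, hs, rfl⟩ := key j (h.sub _ _ hj).2.1
    exact ⟨s, mem_pullP.2 ⟨hi, hs, hj⟩⟩

theorem pullP_pullP {V V' : Finset ℕ} {P : Finset (ℕ × ℕ)} {f g : ℕ → ℕ}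
    (hP : ∀ i j, (i, j) ∈ P → i ∈ V ∧ j ∈ V)
    (hf : ∀ i ∈ V, f i ∈ V' ∧ g (f i) = i) :
    pullP V f (pullP V' g P) = P := by
  ext ⟨i, j⟩
  rw [mem_pullP, mem_pullP]
  constructor
  · rintro ⟨hi, hj, _, _, h⟩
    rwa [(hf i hi).2, (hf j hj).2] at h
  · intro h
    obtain ⟨hi, hj⟩ := hP i j h
    refine ⟨hi, hj, (hf i hi).1, (hf j hj).1, ?_⟩
    rwa [(hf i hi).2, (hf j hj).2]

theorem Tab.leaf_del {V : Finset ℕ} {lt cell : ℕ → ℕ → Prop} {P : Finset (ℕ × ℕ)} {x y : ℕ}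
    (h : Tab V lt cell P) (hx0 : x ≠ 0) (hxy : x ≠ y)
    (irx : ¬ lt x x) (iry : ¬ lt y y)
    (last : ∀ u ∈ V, u ≠ x → cell y u → lt u x ∧ ¬ lt x u)
    (hP : (x, y) ∈ P) (only : ∀ u, (x, u) ∈ P → u = y) :
    Tab (V.erase x) lt cell (P \ {(x, y), (y, x)}) := by
  have hmem : ∀ i j, (i, j) ∈ P \ {(x, y), (y, x)} ↔ (i, j) ∈ P ∧ i ≠ x ∧ j ≠ x := by
    intro i j
    have := only j
    have := only i
    have := h.symm i j
    simp only [mem_sdiff, mem_insert, mem_singleton, Prod.mk.injEq]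
    constructor
    · rintro ⟨h1, h2⟩
      refine ⟨h1, ?_, ?_⟩
      · rintro rfl
        exact h2 (Or.inl ⟨rfl, by tauto⟩)
      · rintro rfl
        exact h2 (Or.inr ⟨by tauto, rfl⟩)
    · rintro ⟨h1, h2, h3⟩
      exact ⟨h1, by tauto⟩
  have other : ∃ k, k ≠ x ∧ (y, k) ∈ P := by
    have h1 := h.cond y x (h.symm _ _ hP) (by tauto)
    have h2 : ¬ ∃ r, lt r y ∧ (r, x) ∈ P := by
      rintro ⟨r, hr, hr'⟩
      rw [only r (h.symm _ _ hr')] at hr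
      exact iry hr
    rw [h1, not_not] at h2
    obtain ⟨k, hk, hk'⟩ := h2
    exact ⟨k, by rintro rfl; exact irx hk, hk'⟩
  constructor
  · intro i j hij
    rw [hmem] at hij
    have := h.sub i j hij.1
    simp only [mem_erase]
    tauto
  · intro i j hij
    rw [hmem] at hij ⊢
    exact ⟨h.symm _ _ hij.1, hij.2.2, hij.2.1⟩
  · rw [hmem]
    exact ⟨h.root, hx0.symm, hx0.symm⟩
  · intro i j hij hne
    rw [hmem] at hij
    obtain ⟨hij, hi, hj⟩ := hij
    have e1 : (∃ r, lt r i ∧ (r, j) ∈ P \ {(x, y), (y, x)}) ↔ (∃ r, lt r i ∧ (r, j) ∈ P) := by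
      constructor
      · rintro ⟨r, h1, h2⟩
        exact ⟨r, h1, ((hmem _ _).1 h2).1⟩
      · rintro ⟨r, h1, h2⟩
        refine ⟨r, h1, (hmem _ _).2 ⟨h2, ?_, hj⟩⟩
        rintro rfl
        have := only j h2
        subst this
        have h3 := h.sub _ _ (h.symm _ _ hij)
        exact (last i h3.2.1 hi h3.2.2).2 h1
    have e2 : (∃ r, lt r j ∧ (i, r) ∈ P \ {(x, y), (y, x)}) ↔ (∃ r, lt r j ∧ (i, r) ∈ P) := by
      constructor
      · rintro ⟨r, h1, h2⟩
        exact ⟨r, h1, ((hmem _ _).1 h2).1⟩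
      · rintro ⟨r, h1, h2⟩
        refine ⟨r, h1, (hmem _ _).2 ⟨h2, hi, ?_⟩⟩
        rintro rfl
        have := only i (h.symm _ _ h2)
        subst this
        have h3 := h.sub _ _ hij
        exact (last j h3.2.1 hj h3.2.2).2 h1
    rw [e1, e2]
    exact h.cond i j hij hne
  · intro i hi
    rw [mem_erase] at hi
    by_cases hiy : i = y
    · subst hiy
      obtain ⟨k, hk, hk'⟩ := other
      exact ⟨k, (hmem _ _).2 ⟨hk', hi.1, hk⟩⟩
    · obtain ⟨j, hj⟩ := h.cov i hi.2
      refine ⟨j, (hmem _ _).2 ⟨hj, hi.1, ?_⟩⟩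
      rintro rfl
      exact hiy (only i (h.symm _ _ hj))

theorem Tab.leaf_ins {V : Finset ℕ} {lt cell : ℕ → ℕ → Prop} {P : Finset (ℕ × ℕ)} {x y : ℕ}
    (h : Tab (V.erase x) lt cell P) (hxV : x ∈ V) (hyV : y ∈ V) (hx0 : x ≠ 0) (hxy : x ≠ y)
    (iry : ¬ lt y y)
    (cxy : cell x y) (cyx : cell y x)
    (last : ∀ u ∈ V, u ≠ x → cell y u → lt u x ∧ ¬ lt x u) :
    Tab V lt cell (insert (x, y) (insert (y, x) P)) := by
  have hmem : ∀ i j, (i, j) ∈ insert (x, y) (insert (y, x) P) ↔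
      (i = x ∧ j = y) ∨ (i = y ∧ j = x) ∨ (i, j) ∈ P := by
    intro i j
    simp only [mem_insert, Prod.mk.injEq]
  have hPx : ∀ i j, (i, j) ∈ P → i ≠ x ∧ j ≠ x ∧ i ∈ V ∧ j ∈ V ∧ cell i j := by
    intro i j hij
    have := h.sub i j hij
    simp only [mem_erase] at this
    tauto
  obtain ⟨z, hz⟩ := h.cov y (mem_erase.2 ⟨hxy.symm, hyV⟩)
  have hz' := hPx _ _ hz
  have hzl := last z hz'.2.2.2.1 hz'.2.1 hz'.2.2.2.2
  constructor
  · intro i j hij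
    rw [hmem] at hij
    rcases hij with ⟨rfl, rfl⟩ | ⟨rfl, rfl⟩ | hij
    · exact ⟨hxV, hyV, cxy⟩
    · exact ⟨hyV, hxV, cyx⟩
    · exact (hPx i j hij).2.2
  · intro i j hij
    rw [hmem] at hij ⊢
    have := h.symm i j
    tauto
  · rw [hmem]
    exact Or.inr (Or.inr h.root)
  · intro i j hij hne
    simp only [hmem] at hij ⊢
    rcases hij with ⟨rfl, rfl⟩ | ⟨rfl, rfl⟩ | hij
    · have h1 : ∃ r, lt r i ∧ (r = i ∧ j = j ∨ r = j ∧ j = i ∨ (r, j) ∈ P) :=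
        ⟨z, hzl.1, Or.inr (Or.inr (h.symm _ _ hz))⟩
      have h2 : ¬ ∃ k, lt k j ∧ (i = i ∧ k = j ∨ i = j ∧ k = i ∨ (i, k) ∈ P) := by
        rintro ⟨k, hk, h3 | h3 | h3⟩
        · rw [h3.2] at hk; exact iry hk
        · exact hxy h3.1
        · exact (hPx _ _ h3).1 rfl
      exact iff_of_true h1 h2
    · have h1 : ∃ k, lt k j ∧ (i = j ∧ k = i ∨ i = i ∧ k = j ∨ (i, k) ∈ P) :=
        ⟨z, hzl.1, Or.inr (Or.inr hz)⟩
      have h2 : ¬ ∃ r, lt r i ∧ (r = j ∧ j = i ∨ r = i ∧ j = j ∨ (r, j) ∈ P) := by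
        rintro ⟨k, hk, h3 | h3 | h3⟩
        · exact hxy h3.2
        · rw [h3.1] at hk; exact iry hk
        · exact (hPx _ _ h3).2.1 rfl
      exact iff_of_false h2 (not_not.2 h1)
    · have h3 := hPx _ _ hij
      have h3' := hPx _ _ (h.symm _ _ hij)
      have e1 : (∃ r, lt r i ∧ (r = x ∧ j = y ∨ r = y ∧ j = x ∨ (r, j) ∈ P)) ↔
          (∃ r, lt r i ∧ (r, j) ∈ P) := by
        constructor
        · rintro ⟨r, h1, ⟨rfl, rfl⟩ | ⟨rfl, rfl⟩ | h2⟩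
          · exact absurd h1 (last i h3'.2.2.2.1 h3.1 h3'.2.2.2.2).2
          · exact absurd rfl h3.2.1
          · exact ⟨r, h1, h2⟩
        · rintro ⟨r, h1, h2⟩
          exact ⟨r, h1, Or.inr (Or.inr h2)⟩
      have e2 : (∃ r, lt r j ∧ (i = x ∧ r = y ∨ i = y ∧ r = x ∨ (i, r) ∈ P)) ↔
          (∃ r, lt r j ∧ (i, r) ∈ P) := by
        constructor
        · rintro ⟨r, h1, ⟨rfl, rfl⟩ | ⟨rfl, rfl⟩ | h2⟩
          · exact absurd rfl h3.1
          · exact absurd h1 (last j h3.2.2.2.1 h3.2.1 h3.2.2.2.2).2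
          · exact ⟨r, h1, h2⟩
        · rintro ⟨r, h1, h2⟩
          exact ⟨r, h1, Or.inr (Or.inr h2)⟩
      rw [e1, e2]
      exact h.cond i j hij hne
  · intro i hi
    simp only [hmem]
    by_cases hix : i = x
    · exact ⟨y, Or.inl ⟨hix, rfl⟩⟩
    · obtain ⟨j, hj⟩ := h.cov i (mem_erase.2 ⟨hix, hi⟩)
      exact ⟨j, Or.inr (Or.inr hj)⟩

/-! ### The model -/

open scoped Classical in
/-- Pairs (half-word, points) on the labels `0, …, m-1`. -/
noncomputable def XX (m : ℕ) : Finset (Finset ℕ × Finset (ℕ × ℕ)) :=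
  ((range m).powerset ×ˢ (range m ×ˢ range m).powerset).filter
    (fun T => Tab (range m) (Prec T.1) (Cel T.1) T.2)

theorem mem_XX {m : ℕ} {T : Finset ℕ × Finset (ℕ × ℕ)} :
    T ∈ XX m ↔ T.1 ⊆ range m ∧ Tab (range m) (Prec T.1) (Cel T.1) T.2 := by
  simp only [XX, mem_filter, mem_product, mem_powerset]
  constructor
  · tauto
  · rintro ⟨h1, h2⟩
    refine ⟨⟨h1, ?_⟩, h2⟩
    rintro ⟨i, j⟩ hij
    have := h2.sub i j hij
    exact mem_product.2 ⟨this.1, this.2.1⟩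

theorem zero_mem_of_XX {m : ℕ} {T : Finset ℕ × Finset (ℕ × ℕ)} (h : T ∈ XX m) : 0 ∈ T.1 := by
  have h1 := (mem_XX.1 h).2
  have h2 := (h1.sub 0 0 h1.root).2.2
  simpa [Cel] using h2

/-- Transposition of `k` and `k+1`. -/
def tau (k i : ℕ) : ℕ := if i = k then k + 1 else if i = k + 1 then k else i

/-- Skip the label `x`. -/
def sig (x i : ℕ) : ℕ := if i < x then i else i + 1

/-- Left inverse of `sig`. -/
def ppi (x i : ℕ) : ℕ := if i < x then i else i - 1

/-- Renumbering of a half-word. -/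
def pullPS (V' : Finset ℕ) (g : ℕ → ℕ) (S : Finset ℕ) : Finset ℕ := V'.filter fun i => g i ∈ S

theorem mem_pullPS {V' : Finset ℕ} {g : ℕ → ℕ} {S : Finset ℕ} {i : ℕ} :
    i ∈ pullPS V' g S ↔ i ∈ V' ∧ g i ∈ S := by simp [pullPS]

theorem pullPS_pullPS {V V' S : Finset ℕ} {f g : ℕ → ℕ} (hP : S ⊆ V)
    (hf : ∀ i ∈ V, f i ∈ V' ∧ g (f i) = i) :
    pullPS V f (pullPS V' g S) = S := by
  ext i
  rw [mem_pullPS, mem_pullPS]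
  constructor
  · rintro ⟨hi, _, h⟩
    rwa [(hf i hi).2] at h
  · intro h
    refine ⟨hP h, (hf i (hP h)).1, ?_⟩
    rwa [(hf i (hP h)).2]

theorem tau_mem {m k : ℕ} (hk : k + 1 < m) :
    ∀ i ∈ range m, tau k i ∈ range m ∧ tau k (tau k i) = i := by
  intro i hi
  simp only [mem_range] at *
  unfold tau
  split_ifs <;> omega

theorem swap_aux {m k : ℕ} (hk1 : 1 ≤ k) (hk : k + 1 < m) {T : Finset ℕ × Finset (ℕ × ℕ)}
    (hT : T ∈ XX m) (hS : (k ∈ T.1 ∧ k + 1 ∉ T.1 ∧ (k, k + 1) ∉ T.2) ∨ (k ∉ T.1 ∧ k + 1 ∈ T.1)) :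
    (pullPS (range m) (tau k) T.1, pullP (range m) (tau k) T.2) ∈ XX m := by
  obtain ⟨S, P⟩ := T
  rw [mem_XX] at hT ⊢
  obtain ⟨h1, h2⟩ := hT
  dsimp only at *
  have hd : ¬ (k ∈ S ∧ k + 1 ∈ S) := by tauto
  have hd' : k ∈ S ∨ k + 1 ∈ S := by tauto
  refine ⟨filter_subset _ _, h2.pullP (tau_mem hk) (tau_mem hk) ?_ ?_ ?_ ?_⟩
  · have h3 : 0 ≠ k := by omega
    simp [tau, h3]
  · rw [mem_range]; omega
  · intro i hi j hj
    simp only [Prec, mem_pullPS, hi, hj, true_and]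
    have hi' : tau k i = i ∧ i ≠ k ∧ i ≠ k + 1 ∨ i = k ∧ tau k i = k + 1 ∨ i = k + 1 ∧ tau k i = k := by
      unfold tau; split_ifs <;> omega
    have hj' : tau k j = j ∧ j ≠ k ∧ j ≠ k + 1 ∨ j = k ∧ tau k j = k + 1 ∨ j = k + 1 ∧ tau k j = k := by
      unfold tau; split_ifs <;> omega
    grind
  · intro i hi j hj hij
    have hc := (h2.sub _ _ hij).2.2
    have hs := h2.symm _ _ hij
    have hb := (h2.sub k (k + 1))
    simp only [Cel, mem_pullPS, hi, hj, true_and] at *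
    have hi' : tau k i = i ∧ i ≠ k ∧ i ≠ k + 1 ∨ i = k ∧ tau k i = k + 1 ∨ i = k + 1 ∧ tau k i = k := by
      unfold tau; split_ifs <;> omega
    have hj' : tau k j = j ∧ j ≠ k ∧ j ≠ k + 1 ∨ j = k ∧ tau k j = k + 1 ∨ j = k + 1 ∧ tau k j = k := by
      unfold tau; split_ifs <;> omega
    grind

theorem tau_k (k : ℕ) : tau k k = k + 1 := by simp [tau]
theorem tau_k1 (k : ℕ) : tau k (k + 1) = k := by simp [tau]
theorem tau_gt {k j : ℕ} (h : k + 1 < j) : tau k j = j := by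
  unfold tau; split_ifs <;> omega

open scoped Classical in
theorem swap_card {m k : ℕ} (hk1 : 1 ≤ k) (hk : k + 1 < m) (Q : Finset ℕ → Prop)
    (hQ : ∀ S ⊆ range m, Q (pullPS (range m) (tau k) S) ↔ Q S) :
    ((XX m).filter (fun T => (k ∈ T.1 ∧ k + 1 ∉ T.1 ∧ (k, k + 1) ∉ T.2) ∧ Q T.1)).card =
    ((XX m).filter (fun T => (k ∉ T.1 ∧ k + 1 ∈ T.1) ∧ Q T.1)).card := by
  have hkm : k ∈ range m := by rw [mem_range]; omega
  have hkm1 : k + 1 ∈ range m := by rw [mem_range]; omega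
  refine Finset.card_nbij'
    (fun T => (pullPS (range m) (tau k) T.1, pullP (range m) (tau k) T.2))
    (fun T => (pullPS (range m) (tau k) T.1, pullP (range m) (tau k) T.2)) ?_ ?_ ?_ ?_
  · intro T hT
    simp only [coe_filter, Set.mem_ofPred_eq] at hT ⊢
    obtain ⟨hT, hS, hQT⟩ := hT
    refine ⟨swap_aux hk1 hk hT (Or.inl hS), ?_, (hQ _ (mem_XX.1 hT).1).2 hQT⟩
    simp only [mem_pullPS, tau_k, tau_k1, hkm, hkm1, true_and]
    tauto
  · intro T hT
    simp only [coe_filter, Set.mem_ofPred_eq] at hT ⊢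
    obtain ⟨hT, hS, hQT⟩ := hT
    refine ⟨swap_aux hk1 hk hT (Or.inr hS), ?_, (hQ _ (mem_XX.1 hT).1).2 hQT⟩
    simp only [mem_pullPS, mem_pullP, tau_k, tau_k1, hkm, hkm1, true_and]
    refine ⟨hS.2, hS.1, fun h => ?_⟩
    have := ((mem_XX.1 hT).2.sub _ _ h).2.2
    simp only [Cel] at this
    have h3 := hS.1
    rcases this with h | h
    · omega
    · exact h3 h.2
  · intro T hT
    simp only [coe_filter, Set.mem_ofPred_eq] at hT
    have h := mem_XX.1 hT.1
    ext1
    · exact pullPS_pullPS h.1 (tau_mem hk)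
    · exact pullP_pullP (fun i j hij => ⟨(h.2.sub i j hij).1, (h.2.sub i j hij).2.1⟩) (tau_mem hk)
  · intro T hT
    simp only [coe_filter, Set.mem_ofPred_eq] at hT
    have h := mem_XX.1 hT.1
    ext1
    · exact pullPS_pullPS h.1 (tau_mem hk)
    · exact pullP_pullP (fun i j hij => ⟨(h.2.sub i j hij).1, (h.2.sub i j hij).2.1⟩) (tau_mem hk)

theorem sig_mem {m x : ℕ} (_hx : x ≤ m) :
    ∀ i ∈ range m, sig x i ∈ (range (m + 1)).erase x ∧ ppi x (sig x i) = i := by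
  intro i hi
  simp only [mem_range, mem_erase] at *
  unfold sig ppi
  split_ifs <;> omega

theorem ppi_mem {m x : ℕ} (hx : x ≤ m) :
    ∀ i ∈ (range (m + 1)).erase x, ppi x i ∈ range m ∧ sig x (ppi x i) = i := by
  intro i hi
  simp only [mem_range, mem_erase] at *
  unfold sig ppi
  split_ifs <;> omega

theorem ppi_lt {x i j : ℕ} (hi : i ≠ x) (hj : j ≠ x) : ppi x i < ppi x j ↔ i < j := by
  unfold ppi
  split_ifs <;> omega

theorem ppi_le {x i j : ℕ} (hi : i ≠ x) (hj : j ≠ x) : ppi x i ≤ ppi x j ↔ i ≤ j := by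
  unfold ppi
  split_ifs <;> omega

/-- Insertion of the label `x` into a tableau on `m` labels (before attaching it). -/
theorem tab_ppi {m x : ℕ} (hx1 : 1 ≤ x) (hx : x ≤ m) {S S' : Finset ℕ} {P : Finset (ℕ × ℕ)}
    (h : Tab (range m) (Prec S) (Cel S) P)
    (hS : ∀ i ∈ (range (m + 1)).erase x, i ∈ S' ↔ ppi x i ∈ S) :
    Tab ((range (m + 1)).erase x) (Prec S') (Cel S')
      (pullP ((range (m + 1)).erase x) (ppi x) P) := by
  refine h.pullP (ppi_mem hx) (sig_mem hx) ?_ ?_ ?_ ?_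
  · unfold ppi; split_ifs <;> omega
  · simp only [mem_range, mem_erase]; omega
  · intro i hi j hj
    have hi' := ne_of_mem_erase hi
    have hj' := ne_of_mem_erase hj
    simp only [Prec, hS i hi, hS j hj, ppi_lt hi' hj', ppi_lt hj' hi']
  · intro i hi j hj hij
    have hi' := ne_of_mem_erase hi
    have hj' := ne_of_mem_erase hj
    have := (h.sub _ _ hij).2.2
    simpa only [Cel, hS i hi, hS j hj, ppi_le hi' hj', ppi_le hj' hi'] using this

/-- Removal of the label `x`, already detached. -/
theorem tab_sig {m x : ℕ} (hx1 : 1 ≤ x) (hx : x ≤ m) {S S' : Finset ℕ} {P : Finset (ℕ × ℕ)}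
    (h : Tab ((range (m + 1)).erase x) (Prec S') (Cel S') P) (hm : 1 ≤ m)
    (hS : ∀ i ∈ range m, i ∈ S ↔ sig x i ∈ S') :
    Tab (range m) (Prec S) (Cel S) (pullP (range m) (sig x) P) := by
  have sig_lt : ∀ i j, sig x i < sig x j ↔ i < j := by
    intro i j; unfold sig; split_ifs <;> omega
  have sig_le : ∀ i j, sig x i ≤ sig x j ↔ i ≤ j := by
    intro i j; unfold sig; split_ifs <;> omega
  refine h.pullP (sig_mem hx) (ppi_mem hx) ?_ ?_ ?_ ?_
  · unfold sig; split_ifs <;> omega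
  · simp only [mem_range]; omega
  · intro i hi j hj
    simp only [Prec, hS i hi, hS j hj, sig_lt]
  · intro i hi j hj hij
    have := (h.sub _ _ hij).2.2
    simpa only [Cel, hS i hi, hS j hj, sig_le] using this

theorem prec_irrefl (S : Finset ℕ) (i : ℕ) : ¬ Prec S i i := by
  simp [Prec]

theorem lastB {S : Finset ℕ} {k : ℕ} (h1 : k ∈ S) (h2 : k + 1 ∉ S) (V : Finset ℕ) :
    ∀ u ∈ V, u ≠ k + 1 → Cel S k u → Prec S u (k + 1) ∧ ¬ Prec S (k + 1) u := by
  intro u _ hu hc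
  unfold Cel at hc
  unfold Prec
  by_cases hS : u ∈ S
  · simp [hS, h2]
  · have h3 : k ≤ u := by
      rcases hc with h | h
      · exact h.1
      · exact absurd h.2 hS
    have h4 : u ≠ k := by rintro rfl; exact hS h1
    simp only [hS, h2, false_and, not_false_eq_true, true_and, false_or]
    omega

theorem lastA {S : Finset ℕ} {k : ℕ} (h1 : k ∈ S) (h2 : k + 1 ∉ S) (V : Finset ℕ) :
    ∀ u ∈ V, u ≠ k → Cel S (k + 1) u → Prec S u k ∧ ¬ Prec S k u := by
  intro u _ hu hc
  unfold Cel at hc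
  unfold Prec
  have h3 : u ≤ k + 1 ∧ u ∈ S := by
    rcases hc with h | h
    · exact absurd h.2 h2
    · exact h
  have h4 : u ≠ k + 1 := by rintro rfl; exact h2 h3.2
  simp only [h3.2, h1, not_true_eq_false, false_and, or_false, true_and, forall_const]
  omega

theorem ppi_succ {k i : ℕ} (h : i ≠ k) : ppi (k + 1) i = ppi k i := by
  unfold ppi; split_ifs <;> omega

theorem pullP_leaf_del {m x y : ℕ} (hx : x ≤ m) {P : Finset (ℕ × ℕ)}
    (hP : ∀ i j, (i, j) ∈ P → i ∈ range m ∧ j ∈ range m) :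
    pullP (range m) (sig x) ((insert (x, y) (insert (y, x)
      (pullP ((range (m + 1)).erase x) (ppi x) P))) \ {(x, y), (y, x)}) = P := by
  have e : (insert (x, y) (insert (y, x)
      (pullP ((range (m + 1)).erase x) (ppi x) P))) \ {(x, y), (y, x)} =
      pullP ((range (m + 1)).erase x) (ppi x) P := by
    ext ⟨i, j⟩
    simp only [mem_sdiff, mem_insert, mem_singleton, mem_pullP, mem_erase, Prod.mk.injEq]
    tauto
  rw [e]
  exact pullP_pullP hP (sig_mem hx)

theorem pullP_leaf_ins {m x y : ℕ} (hx : x ≤ m) {P : Finset (ℕ × ℕ)}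
    (hP : ∀ i j, (i, j) ∈ P → i ∈ range (m + 1) ∧ j ∈ range (m + 1))
    (hs : ∀ i j, (i, j) ∈ P → (j, i) ∈ P)
    (hxy : (x, y) ∈ P) (only : ∀ u, (x, u) ∈ P → u = y) :
    insert (x, y) (insert (y, x) (pullP ((range (m + 1)).erase x) (ppi x)
      (pullP (range m) (sig x) (P \ {(x, y), (y, x)})))) = P := by
  rw [pullP_pullP (V := (range (m + 1)).erase x) _ (ppi_mem hx)]
  · ext ⟨i, j⟩
    have := hs x y hxy
    simp only [mem_sdiff, mem_insert, mem_singleton, Prod.mk.injEq]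
    constructor
    · rintro (⟨rfl, rfl⟩ | ⟨rfl, rfl⟩ | h)
      · exact hxy
      · exact this
      · exact h.1
    · tauto
  · intro i j hij
    simp only [mem_sdiff, mem_insert, mem_singleton, Prod.mk.injEq, mem_erase] at hij ⊢
    have h1 := hP i j hij.1
    refine ⟨⟨?_, h1.1⟩, ?_, h1.2⟩
    · rintro rfl
      exact hij.2 (Or.inl ⟨rfl, only _ hij.1⟩)
    · rintro rfl
      exact hij.2 (Or.inr ⟨only _ (hs _ _ hij.1), rfl⟩)

theorem XX_mem {m : ℕ} {T : Finset ℕ × Finset (ℕ × ℕ)} (h : T ∈ XX m) :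
    ∀ i j, (i, j) ∈ T.2 → i ∈ range m ∧ j ∈ range m := by
  intro i j hij
  have := (mem_XX.1 h).2.sub i j hij
  exact ⟨this.1, this.2.1⟩

open scoped Classical in
theorem occB_card {m k : ℕ} (hk : k < m) (Q Q' : Finset ℕ → Prop)
    (hQ : ∀ S S' : Finset ℕ, (∀ i ∈ range (m + 1), i ≠ k → i ≠ k + 1 →
      (i ∈ S ↔ ppi (k + 1) i ∈ S')) → (Q S ↔ Q' S')) :
    ((XX m).filter (fun T => k ∈ T.1 ∧ Q' T.1)).card =
    ((XX (m + 1)).filter (fun T => ((k ∈ T.1 ∧ k + 1 ∉ T.1 ∧ (k, k + 1) ∈ T.2) ∧ Q T.1) ∧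
      (∀ u, (k + 1, u) ∈ T.2 → u = k))).card := by
  have hx : k + 1 ≤ m := hk
  have hx1 : 1 ≤ k + 1 := by omega
  have hpk : ppi (k + 1) k = k := by simp [ppi]
  have hsk : sig (k + 1) k = k := by simp [sig]
  have hkm : k ∈ (range (m + 1)).erase (k + 1) := by
    simp only [mem_erase, mem_range]; omega
  have hkm' : k ∈ range m := mem_range.2 hk
  refine Finset.card_nbij'
    (fun T => (pullPS ((range (m + 1)).erase (k + 1)) (ppi (k + 1)) T.1,
      insert (k + 1, k) (insert (k, k + 1)
        (pullP ((range (m + 1)).erase (k + 1)) (ppi (k + 1)) T.2))))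
    (fun T => (pullPS (range m) (sig (k + 1)) T.1,
      pullP (range m) (sig (k + 1)) (T.2 \ {(k + 1, k), (k, k + 1)}))) ?_ ?_ ?_ ?_
  · rintro ⟨S, P⟩ hT
    simp only [coe_filter, Set.mem_ofPred_eq] at hT ⊢
    obtain ⟨hT, hkS, hQT⟩ := hT
    have hT' := mem_XX.1 hT
    set S' := pullPS ((range (m + 1)).erase (k + 1)) (ppi (k + 1)) S with hS'
    have h1 : k ∈ S' := by rw [hS', mem_pullPS, hpk]; exact ⟨hkm, hkS⟩
    have h2 : k + 1 ∉ S' := by rw [hS', mem_pullPS]; simp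
    have hS1 : ∀ i ∈ (range (m + 1)).erase (k + 1), i ∈ S' ↔ ppi (k + 1) i ∈ S := by
      intro i hi; rw [hS', mem_pullPS]; exact and_iff_right hi
    refine ⟨mem_XX.2 ⟨(filter_subset _ _).trans (erase_subset _ _), ?_⟩, ⟨⟨h1, h2, ?_⟩, ?_⟩, ?_⟩
    · refine (tab_ppi hx1 hx hT'.2 hS1).leaf_ins ?_ ?_ ?_ ?_ ?_ ?_ ?_ ?_
      · rw [mem_range]; omega
      · rw [mem_range]; omega
      · omega
      · omega
      · exact prec_irrefl _ _
      · exact Or.inr ⟨by omega, h1⟩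
      · exact Or.inl ⟨by omega, h1⟩
      · exact lastB h1 h2 _
    · simp
    · refine (hQ S' S ?_).2 hQT
      intro i hi hi1 hi2
      exact hS1 i (mem_erase.2 ⟨hi2, hi⟩)
    · intro u hu
      simp only [mem_insert, Prod.mk.injEq, mem_pullP, mem_erase] at hu
      rcases hu with h | h | h
      · exact h.2
      · omega
      · exact absurd rfl h.1.1
  · rintro ⟨S, P⟩ hT
    simp only [coe_filter, Set.mem_ofPred_eq] at hT ⊢
    obtain ⟨hT, ⟨⟨h1, h2, h3⟩, hQT⟩, only⟩ := hT
    have hT' := mem_XX.1 hT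
    have hS1 : ∀ i ∈ range m, i ∈ pullPS (range m) (sig (k + 1)) S ↔ sig (k + 1) i ∈ S := by
      intro i hi; rw [mem_pullPS]; exact and_iff_right hi
    refine ⟨mem_XX.2 ⟨filter_subset _ _, ?_⟩, ?_, ?_⟩
    · refine tab_sig hx1 hx (hT'.2.leaf_del ?_ ?_ ?_ ?_ ?_ ?_ only) (by omega) hS1
      · omega
      · omega
      · exact prec_irrefl _ _
      · exact prec_irrefl _ _
      · exact lastB h1 h2 _
      · exact hT'.2.symm _ _ h3
    · rw [hS1 k hkm', hsk]; exact h1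
    · refine (hQ S _ ?_).1 hQT
      intro i hi hi1 hi2
      have := ppi_mem hx i (mem_erase.2 ⟨hi2, hi⟩)
      rw [hS1 _ this.1, this.2]
  · rintro ⟨S, P⟩ hT
    simp only [coe_filter, Set.mem_ofPred_eq] at hT
    have h := mem_XX.1 hT.1
    ext1
    · exact pullPS_pullPS h.1 (sig_mem hx)
    · exact pullP_leaf_del hx (XX_mem hT.1)
  · rintro ⟨S, P⟩ hT
    simp only [coe_filter, Set.mem_ofPred_eq] at hT
    obtain ⟨hT, ⟨⟨h1, h2, h3⟩, hQT⟩, only⟩ := hT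
    have h := mem_XX.1 hT
    ext1
    · refine pullPS_pullPS ?_ (ppi_mem hx)
      intro i hi
      exact mem_erase.2 ⟨by rintro rfl; exact h2 hi, h.1 hi⟩
    · exact pullP_leaf_ins hx (XX_mem hT) h.2.symm (h.2.symm _ _ h3) only

open scoped Classical in
theorem occA_card {m k : ℕ} (hk1 : 1 ≤ k) (hk : k < m) (Q Q' : Finset ℕ → Prop)
    (hQ : ∀ S S' : Finset ℕ, (∀ i ∈ range (m + 1), i ≠ k → i ≠ k + 1 →
      (i ∈ S ↔ ppi (k + 1) i ∈ S')) → (Q S ↔ Q' S')) :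
    ((XX m).filter (fun T => k ∉ T.1 ∧ Q' T.1)).card =
    ((XX (m + 1)).filter (fun T => ((k ∈ T.1 ∧ k + 1 ∉ T.1 ∧ (k, k + 1) ∈ T.2) ∧ Q T.1) ∧
      (∀ u, (k, u) ∈ T.2 → u = k + 1))).card := by
  have hx : k ≤ m := hk.le
  have hpk : ppi k (k + 1) = k := by simp [ppi]
  have hsk : sig k k = k + 1 := by simp [sig]
  have hkm' : k ∈ range m := mem_range.2 hk
  refine Finset.card_nbij'
    (fun T => (insert k (pullPS ((range (m + 1)).erase k) (ppi k) T.1),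
      insert (k, k + 1) (insert (k + 1, k)
        (pullP ((range (m + 1)).erase k) (ppi k) T.2))))
    (fun T => (pullPS (range m) (sig k) T.1,
      pullP (range m) (sig k) (T.2 \ {(k, k + 1), (k + 1, k)}))) ?_ ?_ ?_ ?_
  · rintro ⟨S, P⟩ hT
    simp only [coe_filter, Set.mem_ofPred_eq] at hT ⊢
    obtain ⟨hT, hkS, hQT⟩ := hT
    have hT' := mem_XX.1 hT
    set S' := insert k (pullPS ((range (m + 1)).erase k) (ppi k) S) with hS'
    have hS1 : ∀ i ∈ (range (m + 1)).erase k, i ∈ S' ↔ ppi k i ∈ S := by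
      intro i hi
      rw [hS', mem_insert, mem_pullPS]
      have := ne_of_mem_erase hi
      tauto
    have h1 : k ∈ S' := mem_insert_self _ _
    have h2 : k + 1 ∉ S' := by
      rw [hS1, hpk]
      · exact hkS
      · simp only [mem_erase, mem_range]; omega
    refine ⟨mem_XX.2 ⟨?_, ?_⟩, ⟨⟨h1, h2, ?_⟩, ?_⟩, ?_⟩
    · refine insert_subset (mem_range.2 (by omega)) ?_
      exact (filter_subset _ _).trans (erase_subset _ _)
    · refine (tab_ppi hk1 hx hT'.2 hS1).leaf_ins ?_ ?_ ?_ ?_ ?_ ?_ ?_ ?_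
      · rw [mem_range]; omega
      · rw [mem_range]; omega
      · omega
      · omega
      · exact prec_irrefl _ _
      · exact Or.inl ⟨by omega, h1⟩
      · exact Or.inr ⟨by omega, h1⟩
      · exact lastA h1 h2 _
    · simp
    · refine (hQ S' S ?_).2 hQT
      intro i hi hi1 hi2
      rw [ppi_succ hi1]
      exact hS1 i (mem_erase.2 ⟨hi1, hi⟩)
    · intro u hu
      simp only [mem_insert, Prod.mk.injEq, mem_pullP, mem_erase] at hu
      rcases hu with h | h | h
      · exact h.2
      · omega
      · exact absurd rfl h.1.1
  · rintro ⟨S, P⟩ hT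
    simp only [coe_filter, Set.mem_ofPred_eq] at hT ⊢
    obtain ⟨hT, ⟨⟨h1, h2, h3⟩, hQT⟩, only⟩ := hT
    have hT' := mem_XX.1 hT
    have hS1 : ∀ i ∈ range m, i ∈ pullPS (range m) (sig k) S ↔ sig k i ∈ S := by
      intro i hi; rw [mem_pullPS]; exact and_iff_right hi
    refine ⟨mem_XX.2 ⟨filter_subset _ _, ?_⟩, ?_, ?_⟩
    · refine tab_sig hk1 hx (hT'.2.leaf_del ?_ ?_ ?_ ?_ ?_ h3 only) (by omega) hS1
      · omega
      · omega
      · exact prec_irrefl _ _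
      · exact prec_irrefl _ _
      · exact lastA h1 h2 _
    · rw [hS1 k hkm', hsk]; exact h2
    · refine (hQ S _ ?_).1 hQT
      intro i hi hi1 hi2
      have := ppi_mem hx i (mem_erase.2 ⟨hi1, hi⟩)
      rw [ppi_succ hi1, hS1 _ this.1, this.2]
  · rintro ⟨S, P⟩ hT
    simp only [coe_filter, Set.mem_ofPred_eq] at hT
    have h := mem_XX.1 hT.1
    ext1
    · dsimp only
      rw [show pullPS (range m) (sig k) (insert k (pullPS ((range (m + 1)).erase k) (ppi k) S))
        = pullPS (range m) (sig k) (pullPS ((range (m + 1)).erase k) (ppi k) S) from ?_]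
      · exact pullPS_pullPS h.1 (sig_mem hx)
      · ext i
        rw [mem_pullPS, mem_pullPS, mem_insert]
        have : sig k i ≠ k := by unfold sig; split_ifs <;> omega
        tauto
    · exact pullP_leaf_del hx (XX_mem hT.1)
  · rintro ⟨S, P⟩ hT
    simp only [coe_filter, Set.mem_ofPred_eq] at hT
    obtain ⟨hT, ⟨⟨h1, h2, h3⟩, hQT⟩, only⟩ := hT
    have h := mem_XX.1 hT
    ext1
    · dsimp only
      rw [show pullPS (range m) (sig k) S = pullPS (range m) (sig k) (S.erase k) from ?_]
      · rw [pullPS_pullPS (V := (range (m + 1)).erase k) _ (ppi_mem hx)]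
        · exact insert_erase h1
        · exact erase_subset_erase _ h.1
      · ext i
        rw [mem_pullPS, mem_pullPS, mem_erase]
        have : sig k i ≠ k := by unfold sig; split_ifs <;> omega
        tauto
    · exact pullP_leaf_ins hx (XX_mem hT) h.2.symm h3 only

open scoped Classical in
theorem occ_card {m k : ℕ} (hk : k < m) (Q Q' : Finset ℕ → Prop)
    (hQ : ∀ S S' : Finset ℕ, (∀ i ∈ range (m + 1), i ≠ k → i ≠ k + 1 →
      (i ∈ S ↔ ppi (k + 1) i ∈ S')) → (Q S ↔ Q' S')) :
    ((XX (m + 1)).filter (fun T => (k ∈ T.1 ∧ k + 1 ∉ T.1 ∧ (k, k + 1) ∈ T.2) ∧ Q T.1)).card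
    = ((XX m).filter (fun T => Q' T.1)).card := by
  have eB := occB_card hk Q Q' hQ
  have eA : ((XX m).filter (fun T => k ∉ T.1 ∧ Q' T.1)).card =
    ((XX (m + 1)).filter (fun T => ((k ∈ T.1 ∧ k + 1 ∉ T.1 ∧ (k, k + 1) ∈ T.2) ∧ Q T.1) ∧
      (∀ u, (k, u) ∈ T.2 → u = k + 1))).card := by
    rcases Nat.eq_zero_or_pos k with h0 | h0
    · subst h0
      rw [filter_false_of_mem, filter_false_of_mem]
      · intro T hT h
        have := h.2 0 (mem_XX.1 hT).2.root
        omega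
      · intro T hT h
        exact h.1 (zero_mem_of_XX hT)
    · exact occA_card h0 hk Q Q' hQ
  have key : ((XX (m + 1)).filter (fun T => ((k ∈ T.1 ∧ k + 1 ∉ T.1 ∧ (k, k + 1) ∈ T.2) ∧ Q T.1) ∧
      (∀ u, (k, u) ∈ T.2 → u = k + 1))) =
      ((XX (m + 1)).filter (fun T => ((k ∈ T.1 ∧ k + 1 ∉ T.1 ∧ (k, k + 1) ∈ T.2) ∧ Q T.1) ∧
      ¬ (∀ u, (k + 1, u) ∈ T.2 → u = k))) := by
    apply filter_congr
    intro T hT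
    apply and_congr_right
    rintro ⟨⟨h1, h2, h3⟩, _⟩
    have h := (mem_XX.1 hT).2
    have hc := h.cond _ _ h3 (by omega)
    have c1 : (∀ u, (k, u) ∈ T.2 → u = k + 1) ↔ ¬ ∃ u, Prec T.1 u (k + 1) ∧ (k, u) ∈ T.2 := by
      constructor
      · rintro h4 ⟨u, h5, h6⟩
        rw [h4 u h6] at h5
        exact prec_irrefl _ _ h5
      · intro h4 u hu
        by_contra hne
        have h5 := h.sub _ _ hu
        exact h4 ⟨u, (lastB h1 h2 _ u h5.2.1 hne h5.2.2).1, hu⟩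
    have c2 : (∀ u, (k + 1, u) ∈ T.2 → u = k) ↔ ¬ ∃ u, Prec T.1 u k ∧ (u, k + 1) ∈ T.2 := by
      constructor
      · rintro h4 ⟨u, h5, h6⟩
        rw [h4 u (h.symm _ _ h6)] at h5
        exact prec_irrefl _ _ h5
      · intro h4 u hu
        by_contra hne
        have h5 := h.sub _ _ hu
        exact h4 ⟨u, (lastA h1 h2 _ u h5.2.1 hne h5.2.2).1, h.symm _ _ hu⟩
    rw [c1, c2, not_not, hc]
  rw [key] at eA
  have t1 := card_filter_add_card_filter_not (s := (XX (m + 1)).filter (fun T =>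
    (k ∈ T.1 ∧ k + 1 ∉ T.1 ∧ (k, k + 1) ∈ T.2) ∧ Q T.1)) (fun T => ∀ u, (k + 1, u) ∈ T.2 → u = k)
  have t2 := card_filter_add_card_filter_not (s := (XX m).filter (fun T => Q' T.1))
    (fun T => k ∈ T.1)
  simp only [filter_filter] at t1 t2
  simp only [and_comm (a := k ∈ _) (b := Q' _), and_comm (a := k ∉ _) (b := Q' _)] at eA eB
  omega

/-! ### Counting in the model -/

theorem Tab.diag {V : Finset ℕ} {lt cell : ℕ → ℕ → Prop} {P : Finset (ℕ × ℕ)}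
    (h : Tab V lt cell P) {i : ℕ} (hi : (i, i) ∈ P) : i = 0 := by
  by_contra h0
  have h1 := h.cond i i hi (by tauto)
  have h2 : (∃ r, lt r i ∧ (r, i) ∈ P) ↔ (∃ k, lt k i ∧ (i, k) ∈ P) := by
    constructor
    · rintro ⟨r, h3, h4⟩; exact ⟨r, h3, h.symm _ _ h4⟩
    · rintro ⟨r, h3, h4⟩; exact ⟨r, h3, h.symm _ _ h4⟩
  rw [h2] at h1
  exact iff_not_self h1

theorem toggle_aux {m : ℕ} (hm : 1 ≤ m) {S S' : Finset ℕ} {P : Finset (ℕ × ℕ)}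
    (h : (S, P) ∈ XX (m + 1)) (hS' : S' ⊆ range (m + 1)) (hS : ∀ i, i ≠ m → (i ∈ S' ↔ i ∈ S)) :
    (S', P) ∈ XX (m + 1) := by
  rw [mem_XX] at h ⊢
  refine ⟨hS', ?_⟩
  have h2 := h.2
  have e : pullP (range (m + 1)) id P = P := by
    ext ⟨i, j⟩
    have := h2.sub i j
    rw [mem_pullP]
    simp only [id]
    tauto
  dsimp only
  rw [← e]
  refine h2.pullP (f := id) (g := id) (by simp) (by simp) rfl (by simp) ?_ ?_
  · intro i hi j hj
    have := hS i
    have := hS j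
    simp only [mem_range, id, Prec] at *
    by_cases h3 : i = m <;> by_cases h4 : j = m <;> grind
  · intro i hi j hj hij
    have h3 := (h2.sub _ _ hij).2.2
    have h4 := hS i
    have h5 := hS j
    have h6 : ¬ (i = m ∧ j = m) := by
      rintro ⟨rfl, rfl⟩
      have := h2.diag hij
      simp only [id] at this
      omega
    simp only [mem_range, id, Cel] at *
    by_cases h3 : i = m <;> by_cases h4 : j = m <;> grind

open scoped Classical in
theorem toggle_card {m : ℕ} (hm : 1 ≤ m) :
    ((XX (m + 1)).filter (fun T => m ∈ T.1)).card =
    ((XX (m + 1)).filter (fun T => m ∉ T.1)).card := by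
  refine Finset.card_nbij' (fun T => (T.1.erase m, T.2)) (fun T => (insert m T.1, T.2)) ?_ ?_ ?_ ?_
  · rintro ⟨S, P⟩ hT
    simp only [coe_filter, Set.mem_ofPred_eq] at hT ⊢
    refine ⟨toggle_aux hm hT.1 ((erase_subset _ _).trans (mem_XX.1 hT.1).1) ?_, by simp⟩
    intro i hi
    simp [hi]
  · rintro ⟨S, P⟩ hT
    simp only [coe_filter, Set.mem_ofPred_eq] at hT ⊢
    refine ⟨toggle_aux hm hT.1 (insert_subset (by simp) (mem_XX.1 hT.1).1) ?_, by simp⟩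
    intro i hi
    simp [hi]
  · rintro ⟨S, P⟩ hT
    simp only [coe_filter, Set.mem_ofPred_eq] at hT ⊢
    rw [insert_erase hT.2]
  · rintro ⟨S, P⟩ hT
    simp only [coe_filter, Set.mem_ofPred_eq] at hT ⊢
    rw [erase_insert hT.2]

open scoped Classical in
theorem noc_swap {m k : ℕ} (hk : k + 1 < m) (Q : Finset ℕ → Prop)
    (hQ : ∀ S ⊆ range m, Q (pullPS (range m) (tau k) S) ↔ Q S) :
    ((XX m).filter (fun T => (k ∈ T.1 ∧ k + 1 ∉ T.1 ∧ (k, k + 1) ∉ T.2) ∧ Q T.1)).card =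
    ((XX m).filter (fun T => (k ∉ T.1 ∧ k + 1 ∈ T.1) ∧ Q T.1)).card := by
  rcases Nat.eq_zero_or_pos k with h0 | h0
  · subst h0
    rw [filter_false_of_mem, filter_false_of_mem]
    · intro T hT h
      exact h.1.1 (zero_mem_of_XX hT)
    · rintro ⟨S, P⟩ hT ⟨⟨h1, h2, h3⟩, -⟩
      have h := (mem_XX.1 hT).2
      obtain ⟨j, hj⟩ := h.cov 1 (mem_range.2 hk)
      have h4 := (h.sub _ _ hj).2.2
      have h5 := h.symm _ _ hj
      dsimp only at *
      have h6 : j ≠ 0 := by rintro rfl; exact h3 h5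
      have h7 : j ≠ 1 := by rintro rfl; have := h.diag hj; omega
      rcases h4 with h4 | h4
      · exact h2 h4.2
      · omega
  · exact swap_card h0 hk Q hQ

open scoped Classical in
theorem step_card {m k : ℕ} (hk : k < m) (Q Q' : Finset ℕ → Prop)
    (hQ1 : ∀ S ⊆ range (m + 1), Q (pullPS (range (m + 1)) (tau k) S) ↔ Q S)
    (hQ : ∀ S S' : Finset ℕ, (∀ i ∈ range (m + 1), i ≠ k → i ≠ k + 1 →
      (i ∈ S ↔ ppi (k + 1) i ∈ S')) → (Q S ↔ Q' S')) :
    ((XX (m + 1)).filter (fun T => k + 1 ∉ T.1 ∧ Q T.1)).card =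
    ((XX (m + 1)).filter (fun T => k ∉ T.1 ∧ Q T.1)).card +
    ((XX m).filter (fun T => Q' T.1)).card := by
  have h1 := occ_card hk Q Q' hQ
  have h2 := noc_swap (m := m + 1) (k := k) (by omega) Q hQ1
  have t1 := card_filter_add_card_filter_not (s := (XX (m + 1)).filter (fun T =>
    k + 1 ∉ T.1 ∧ Q T.1)) (fun T => k ∈ T.1)
  have t2 := card_filter_add_card_filter_not (s := (XX (m + 1)).filter (fun T =>
    (k + 1 ∉ T.1 ∧ Q T.1) ∧ k ∈ T.1)) (fun T => (k, k + 1) ∈ T.2)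
  have t3 := card_filter_add_card_filter_not (s := (XX (m + 1)).filter (fun T =>
    k ∉ T.1 ∧ Q T.1)) (fun T => k + 1 ∈ T.1)
  simp only [filter_filter] at t1 t2 t3
  have e1 : ((XX (m + 1)).filter (fun T => (k + 1 ∉ T.1 ∧ Q T.1) ∧ ¬ k ∈ T.1)) =
      ((XX (m + 1)).filter (fun T => (k ∉ T.1 ∧ Q T.1) ∧ ¬ k + 1 ∈ T.1)) :=
    filter_congr (by intros; tauto)
  have e2 : ((XX (m + 1)).filter (fun T => (k ∉ T.1 ∧ Q T.1) ∧ k + 1 ∈ T.1)) =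
      ((XX (m + 1)).filter (fun T => (k ∉ T.1 ∧ k + 1 ∈ T.1) ∧ Q T.1)) :=
    filter_congr (by intros; tauto)
  have e3 : ((XX (m + 1)).filter (fun T => ((k + 1 ∉ T.1 ∧ Q T.1) ∧ k ∈ T.1) ∧ (k, k + 1) ∈ T.2)) =
      ((XX (m + 1)).filter (fun T => (k ∈ T.1 ∧ k + 1 ∉ T.1 ∧ (k, k + 1) ∈ T.2) ∧ Q T.1)) :=
    filter_congr (by intros; tauto)
  have e4 : ((XX (m + 1)).filter (fun T => ((k + 1 ∉ T.1 ∧ Q T.1) ∧ k ∈ T.1) ∧ (k, k + 1) ∉ T.2)) =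
      ((XX (m + 1)).filter (fun T => (k ∈ T.1 ∧ k + 1 ∉ T.1 ∧ (k, k + 1) ∉ T.2) ∧ Q T.1)) :=
    filter_congr (by intros; tauto)
  rw [e3, e4] at t2
  rw [e1] at t1
  rw [e2] at t3
  omega

/-- Number of tableaux in the model. -/
noncomputable def NN (m : ℕ) : ℕ := (XX m).card

open scoped Classical in
/-- Number of tableaux whose `k`-th letter is vertical. -/
noncomputable def aa (m k : ℕ) : ℕ := ((XX m).filter (fun T => k ∈ T.1)).card

open scoped Classical in
theorem zz_eq (m k : ℕ) (hk : k ≤ m) :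
    ((XX (m + 1)).filter (fun T => k ∉ T.1)).card = k * NN m := by
  induction k with
  | zero =>
    rw [filter_false_of_mem]
    · simp
    · intro T hT h
      exact h (zero_mem_of_XX hT)
  | succ k ih =>
    have := step_card (m := m) (k := k) (by omega) (fun _ => True) (fun _ => True)
      (by simp) (by simp)
    simp only [and_true, filter_true] at this
    rw [this, ih (by omega), NN]
    ring

theorem aa_eq (m k : ℕ) (hk : k ≤ m) : aa (m + 1) k + k * NN m = NN (m + 1) := by
  classical
  have t := card_filter_add_card_filter_not (s := XX (m + 1)) (fun T => k ∈ T.1)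
  rw [zz_eq m k hk] at t
  exact t

theorem two_aa (m : ℕ) (hm : 1 ≤ m) : 2 * aa (m + 1) m = NN (m + 1) := by
  classical
  have t := card_filter_add_card_filter_not (s := XX (m + 1)) (fun T => m ∈ T.1)
  rw [← toggle_card hm] at t
  rw [aa, NN]
  omega

theorem NN_succ (m : ℕ) (hm : 1 ≤ m) : NN (m + 1) = 2 * m * NN m := by
  have h1 := aa_eq m m le_rfl
  have h2 := two_aa m hm
  linarith

theorem NN_one : NN 1 = 1 := by
  rw [NN, card_eq_one]
  refine ⟨({0}, {(0, 0)}), ?_⟩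
  ext ⟨S, P⟩
  rw [mem_singleton, Prod.mk.injEq]
  constructor
  · intro h
    have h0 := zero_mem_of_XX h
    rw [mem_XX] at h
    dsimp only at *
    constructor
    · ext i
      rw [mem_singleton]
      constructor
      · intro hi
        have := h.1 hi
        rw [mem_range] at this
        omega
      · rintro rfl; exact h0
    · ext ⟨i, j⟩
      rw [mem_singleton, Prod.mk.injEq]
      constructor
      · intro hi
        have := h.2.sub _ _ hi
        simp only [mem_range] at this
        omega
      · rintro ⟨rfl, rfl⟩; exact h.2.root
  · rintro ⟨rfl, rfl⟩
    rw [mem_XX]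
    refine ⟨by simp, ?_, ?_, ?_, ?_, ?_⟩
    · simp [Cel]
    · simp
    · simp
    · simp
    · simp

theorem NN_eq (n : ℕ) : NN (n + 1) = 2 ^ n * n.factorial := by
  induction n with
  | zero => simp [NN_one]
  | succ n ih =>
    rw [NN_succ _ (by omega), ih, Nat.factorial_succ, pow_succ]
    ring

open scoped Classical in
theorem ee_eq (m k j : ℕ) (hk : k < j) (hj : j ≤ m) :
    ((XX (m + 1)).filter (fun T => k ∉ T.1 ∧ j ∈ T.1)).card = k * aa m (j - 1) := by
  induction k with
  | zero =>
    rw [filter_false_of_mem]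
    · simp
    · intro T hT h
      exact h.1 (zero_mem_of_XX hT)
  | succ k ih =>
    have := step_card (m := m) (k := k) (by omega) (fun S => j ∈ S) (fun S => j - 1 ∈ S) ?_ ?_
    · rw [Nat.succ_mul, ← ih (by omega), aa]
      convert this
    · intro S hS
      rw [mem_pullPS, tau_gt hk, mem_range]
      exact and_iff_right (by omega)
    · intro S S' h
      have := h j (mem_range.2 (by omega)) (by omega) (by omega)
      rw [this, ppi, if_neg (by omega)]

open scoped Classical in
theorem noc_eq (m k : ℕ) (hk : k < m) :
    ((XX (m + 1)).filter (fun T => k ∈ T.1 ∧ k + 1 ∉ T.1 ∧ (k, k + 1) ∉ T.2)).card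
      = k * aa m k := by
  have h := noc_swap (m := m + 1) (k := k) (by omega) (fun _ => True) (by simp)
  simp only [and_true] at h
  rw [h, ee_eq m k (k + 1) (by omega) hk]
  simp

theorem final_count (n : ℕ) (hn : 2 ≤ n) :
    12 * (2 * ∑ k ∈ range n, k * aa n k + aa (n + 1) n)
      = 2 ^ n * n.factorial * (4 * n + 1) := by
  obtain ⟨p, rfl⟩ : ∃ p, n = p + 2 := ⟨n - 2, by omega⟩
  rw [← NN_eq]
  have h1 := two_aa (p + 2) (by omega)
  have h2 := NN_succ (p + 2) (by omega)
  have h3 := NN_succ (p + 1) (by omega)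
  have key : ∀ q ≤ p + 2, 6 * ∑ k ∈ range q, (k : ℤ) * aa (p + 2) k =
      3 * (q * (q - 1)) * NN (p + 2) - (q - 1) * q * (2 * q - 1) * NN (p + 1) := by
    intro q hq
    induction q with
    | zero => simp
    | succ q ih =>
      rw [sum_range_succ, mul_add, ih (by omega)]
      have h4 : ((aa (p + 2) q + q * NN (p + 1) : ℕ) : ℤ) = NN (p + 2) := by
        rw [aa_eq (p + 1) q (by omega)]
      push_cast at h4 ⊢
      linear_combination 6 * (q : ℤ) * h4
  have h5 := key (p + 2) le_rfl
  zify at h1 h2 h3 ⊢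
  push_cast at h5
  rw [h3] at h5 h2
  rw [h2] at h1 ⊢
  linear_combination 4 * h5 + 6 * h1

/-! ### From labels to coordinates -/

theorem prec_trans {S : Finset ℕ} {i j k : ℕ} (h1 : Prec S i j) (h2 : Prec S j k) :
    Prec S i k := by
  unfold Prec at *
  by_cases hi : i ∈ S <;> by_cases hj : j ∈ S <;> by_cases hk : k ∈ S <;>
    simp only [hi, hj, hk, true_and, false_and, not_true_eq_false, not_false_eq_true, or_false,
      false_or, forall_const, IsEmpty.forall_iff] at h1 h2 ⊢ <;> omega

theorem prec_total {S : Finset ℕ} {i j : ℕ} (h : i ≠ j) : Prec S i j ∨ Prec S j i := by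
  unfold Prec at *
  by_cases hi : i ∈ S <;> by_cases hj : j ∈ S <;>
    simp only [hi, hj, true_and, false_and, not_true_eq_false, not_false_eq_true, or_false,
      false_or, forall_const, IsEmpty.forall_iff, or_true] <;> omega

open scoped Classical in
/-- Row index of a label. -/
noncomputable def rho (m : ℕ) (S : Finset ℕ) (i : ℕ) : ℕ :=
  ((range m).filter (fun j => Prec S j i)).card

theorem rho_lt_of {m : ℕ} {S : Finset ℕ} {i j : ℕ} (hi : i < m) (h : Prec S i j) :
    rho m S i < rho m S j := by
  classical
  apply card_lt_card
  rw [ssubset_iff_of_subset]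
  · exact ⟨i, by simp [hi, h], by simp [prec_irrefl]⟩
  · intro k hk
    simp only [mem_filter] at hk ⊢
    exact ⟨hk.1, prec_trans hk.2 h⟩

theorem rho_lt_iff {m : ℕ} {S : Finset ℕ} {i j : ℕ} (hi : i < m) (hj : j < m) :
    rho m S i < rho m S j ↔ Prec S i j := by
  refine ⟨fun h => ?_, rho_lt_of hi⟩
  by_contra hn
  by_cases hij : i = j
  · subst hij; omega
  · have := rho_lt_of hj ((prec_total hij).resolve_left hn)
    omega

theorem rho_inj {m : ℕ} {S : Finset ℕ} {i j : ℕ} (hi : i < m) (hj : j < m)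
    (h : rho m S i = rho m S j) : i = j := by
  by_contra hij
  rcases prec_total (S := S) hij with h1 | h1
  · have := rho_lt_of hi h1; omega
  · have := rho_lt_of hj h1; omega

theorem rho_lt {m : ℕ} {S : Finset ℕ} {i : ℕ} (hi : i < m) : rho m S i < m := by
  classical
  have : (((range m).filter (fun j => Prec S j i))).card < (range m).card := by
    apply card_lt_card
    rw [ssubset_iff_of_subset (filter_subset _ _)]
    exact ⟨i, by simp [hi], by simp [prec_irrefl]⟩
  simpa [rho] using this

theorem rho_surj {m : ℕ} {S : Finset ℕ} {r : ℕ} (hr : r < m) : ∃ i < m, rho m S i = r := by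
  have h := Finset.surj_on_of_inj_on_of_card_le (s := range m) (t := range m)
    (fun i _ => rho m S i) (fun i hi => mem_range.2 (rho_lt (mem_range.1 hi)))
    (fun i j hi hj h => rho_inj (mem_range.1 hi) (mem_range.1 hj) h) le_rfl r (mem_range.2 hr)
  obtain ⟨i, hi, h⟩ := h
  exact ⟨i, mem_range.1 hi, h.symm⟩

open scoped Classical in
/-- Label of a row. -/
noncomputable def ell (m : ℕ) (S : Finset ℕ) (r : ℕ) : ℕ :=
  if h : ∃ i < m, rho m S i = r then h.choose else 0

theorem ell_spec {m : ℕ} {S : Finset ℕ} {r : ℕ} (hr : r < m) :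
    ell m S r < m ∧ rho m S (ell m S r) = r := by
  have h := rho_surj (S := S) hr
  rw [ell, dif_pos h]
  exact h.choose_spec

theorem ell_rho {m : ℕ} {S : Finset ℕ} {i : ℕ} (hi : i < m) : ell m S (rho m S i) = i := by
  have h := ell_spec (S := S) (rho_lt (S := S) hi)
  exact rho_inj h.1 hi h.2

theorem rho_mem {m : ℕ} {S : Finset ℕ} :
    ∀ i ∈ range m, rho m S i ∈ range m ∧ ell m S (rho m S i) = i := by
  intro i hi
  rw [mem_range] at *
  exact ⟨rho_lt hi, ell_rho hi⟩

theorem ell_mem {m : ℕ} {S : Finset ℕ} :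
    ∀ i ∈ range m, ell m S i ∈ range m ∧ rho m S (ell m S i) = i := by
  intro i hi
  rw [mem_range] at *
  exact ell_spec hi

theorem prec_ell {m : ℕ} {S : Finset ℕ} {r c : ℕ} (hr : r < m) (hc : c < m) :
    Prec S (ell m S r) (ell m S c) ↔ r < c := by
  have h1 := ell_spec (S := S) hr
  have h2 := ell_spec (S := S) hc
  rw [← rho_lt_iff h1.1 h2.1, h1.2, h2.2]

theorem rho_zero {m : ℕ} {S : Finset ℕ} (h : 0 ∈ S) : rho m S 0 = 0 := by
  classical
  rw [rho, card_eq_zero, filter_eq_empty_iff]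
  intro i _
  simp [Prec, h]

open scoped Classical in
/-- The Young diagram of a half-word. -/
noncomputable def DD (m : ℕ) (S : Finset ℕ) : Finset (ℕ × ℕ) :=
  (range m ×ˢ range m).filter (fun c => Cel S (ell m S c.1) (ell m S c.2))

theorem mem_DD {m : ℕ} {S : Finset ℕ} {r c : ℕ} :
    (r, c) ∈ DD m S ↔ r < m ∧ c < m ∧ Cel S (ell m S r) (ell m S c) := by
  simp [DD, and_assoc]

theorem cel_symm {S : Finset ℕ} {i j : ℕ} : Cel S i j ↔ Cel S j i := by
  unfold Cel; tauto

theorem cel_down {S : Finset ℕ} {i j i' : ℕ} (h : Cel S i j) (hi : Prec S i' i) :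
    Cel S i' j := by
  unfold Cel Prec at *
  by_cases h1 : i ∈ S <;> by_cases h2 : j ∈ S <;> by_cases h3 : i' ∈ S <;>
    simp only [h1, h2, h3, true_and, false_and, and_true, and_false, not_true_eq_false,
      not_false_eq_true, or_false,
      false_or, forall_const, IsEmpty.forall_iff] at h hi ⊢ <;> omega

theorem cel_down' {m : ℕ} {S : Finset ℕ} {r c r' : ℕ} (h : (r, c) ∈ DD m S) (hi : r' ≤ r) :
    (r', c) ∈ DD m S := by
  rw [mem_DD] at h ⊢
  refine ⟨by omega, h.2.1, ?_⟩
  rcases Nat.lt_or_ge r' r with h1 | h1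
  · exact cel_down h.2.2 ((prec_ell (by omega) h.1).2 h1)
  · rw [show r' = r by omega]; exact h.2.2

theorem DD_symm {m : ℕ} {S : Finset ℕ} {r c : ℕ} : (r, c) ∈ DD m S ↔ (c, r) ∈ DD m S := by
  rw [mem_DD, mem_DD, cel_symm]; tauto

theorem DD_young (m : ℕ) (S : Finset ℕ) : IsYoung (DD m S) := by
  intro i j i' j' h hi hj
  have h1 := cel_down' h hi
  rw [DD_symm] at h1 ⊢
  exact cel_down' h1 hj

/-- Recover the half-word from the diagram. -/
theorem DD_recover {m : ℕ} {S : Finset ℕ} (hS : S ⊆ range m) (i : ℕ) :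
    i ∈ S ↔ ∃ r < m, (r, r) ∈ DD m S ∧
      r + ((range m).filter (fun c => (r, c) ∉ DD m S)).card = i := by
  classical
  have key : ∀ j ∈ S, rho m S j +
      ((range m).filter (fun c => (rho m S j, c) ∉ DD m S)).card = j := by
    intro j hj
    have hjm := mem_range.1 (hS hj)
    have e1 : ((range m).filter (fun c => (rho m S j, c) ∉ DD m S)).card =
        ((range m).filter (fun c => c < j ∧ c ∉ S)).card := by
      refine card_nbij' (ell m S) (rho m S) ?_ ?_ ?_ ?_
      · intro c hc
        simp only [coe_filter, Set.mem_ofPred_eq, mem_range, mem_DD] at hc ⊢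
        have h1 := ell_spec (S := S) hc.1
        refine ⟨h1.1, ?_⟩
        have h2 := hc.2
        rw [ell_rho hjm] at h2
        have h3 : ¬ Cel S j (ell m S c) := fun h => h2 ⟨rho_lt hjm, hc.1, h⟩
        simp only [Cel, hj, and_true] at h3
        push Not at h3
        exact ⟨h3.1, h3.2 h3.1.le⟩
      · intro c hc
        simp only [coe_filter, Set.mem_ofPred_eq, mem_range, mem_DD] at hc ⊢
        refine ⟨rho_lt hc.1, ?_⟩
        rintro ⟨_, _, h⟩
        rw [ell_rho hjm, ell_rho hc.1] at h
        rcases h with h | h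
        · omega
        · exact hc.2.2 h.2
      · intro c hc
        simp only [coe_filter, Set.mem_ofPred_eq, mem_range] at hc
        exact (ell_spec hc.1).2
      · intro c hc
        simp only [coe_filter, Set.mem_ofPred_eq, mem_range] at hc
        exact ell_rho hc.1
    have e2 : rho m S j = ((range m).filter (fun c => c < j ∧ c ∈ S)).card := by
      rw [rho]
      congr 1
      apply filter_congr
      intro c hc
      simp only [Prec, hj]
      tauto
    have e3 := card_filter_add_card_filter_not (s := (range m).filter (fun c => c < j))
      (fun c => c ∈ S)
    simp only [filter_filter] at e3
    rw [e1, e2, e3]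
    have : (range m).filter (fun c => c < j) = range j := by
      ext c
      simp only [mem_filter, mem_range]
      omega
    rw [this, card_range]
  constructor
  · intro hi
    have him := mem_range.1 (hS hi)
    refine ⟨rho m S i, rho_lt him, ?_, key i hi⟩
    rw [mem_DD, ell_rho him]
    exact ⟨rho_lt him, rho_lt him, Or.inl ⟨le_rfl, hi⟩⟩
  · rintro ⟨r, hr, h1, h2⟩
    rw [mem_DD] at h1
    have h3 : ell m S r ∈ S := by
      rcases h1.2.2 with h | h <;> exact h.2
    have h4 := key _ h3
    rw [(ell_spec hr).2, h2] at h4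
    rw [h4]; exact h3

theorem DD_inj {m : ℕ} {S S' : Finset ℕ} (hS : S ⊆ range m) (hS' : S' ⊆ range m)
    (h : DD m S = DD m S') : S = S' := by
  ext i
  rw [DD_recover hS, DD_recover hS', h]

theorem mono_id {m : ℕ} {f : ℕ → ℕ} (h1 : ∀ r < m, f r < m)
    (h2 : ∀ r c, r < c → c < m → f r < f c) : ∀ r < m, f r = r := by
  have key : ∀ d r, r + d < m → f r + d ≤ f (r + d) := by
    intro d
    induction d with
    | zero => intro r _; simp
    | succ d ih =>
      intro r hr
      have h3 := ih r (by omega)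
      have h4 := h2 (r + d) (r + (d + 1)) (by omega) hr
      omega
  intro r hr
  have h3 := key r 0 (by omega)
  have h4 := key (m - 1 - r) r (by omega)
  have h5 := h1 (m - 1) (by omega)
  rw [show r + (m - 1 - r) = m - 1 by omega] at h4
  rw [zero_add] at h3
  omega

theorem shape_aux (m : ℕ) : ∀ D : Finset (ℕ × ℕ), IsYoung D → (∀ i j, (i, j) ∈ D ↔ (j, i) ∈ D) →
    (∀ i j, (i, j) ∈ D → i < m ∧ j < m) →
    ∃ S ⊆ range m, ∃ l : ℕ → ℕ, (∀ r < m, l r < m) ∧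
      (∀ r c, r < c → c < m → Prec S (l r) (l c)) ∧
      ∀ r c, r < m → c < m → ((r, c) ∈ D ↔ Cel S (l r) (l c)) := by
  induction m with
  | zero =>
    intro D _ _ _
    exact ⟨∅, by simp, id, by simp, by simp, by simp⟩
  | succ m ih =>
    intro D hY hs hb
    by_cases h0 : (0, m) ∈ D
    · have hf : ∀ c, c ≤ m → (0, c) ∈ D := fun c hc => hY 0 m 0 c h0 le_rfl hc
      let D' : Finset (ℕ × ℕ) := (range m ×ˢ range m).filter (fun c => (c.1 + 1, c.2 + 1) ∈ D)
      have hD' : ∀ i j, (i, j) ∈ D' ↔ (i + 1, j + 1) ∈ D := by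
        intro i j
        simp only [D', mem_filter, mem_product, mem_range]
        constructor
        · exact fun h => h.2
        · intro h
          have := hb _ _ h
          exact ⟨by omega, h⟩
      obtain ⟨S, hS, l, h1, h2, h3⟩ := ih D'
        (by intro i j i' j' h hi hj
            rw [hD'] at h ⊢
            exact hY _ _ _ _ h (by omega) (by omega))
        (by intro i j; rw [hD', hD', hs])
        (by intro i j h
            rw [hD'] at h
            have := hb _ _ h
            omega)
      have hm0 : ∀ i, i + 1 ∈ insert 0 (S.image (· + 1)) ↔ i ∈ S := by
        intro i; simp
      have hm1 : 0 ∈ insert 0 (S.image (· + 1)) := by simp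
      refine ⟨insert 0 (S.image (· + 1)), ?_, fun r => if r = 0 then 0 else l (r - 1) + 1, ?_, ?_, ?_⟩
      · intro i hi
        simp only [mem_insert, mem_image] at hi
        rcases hi with rfl | ⟨j, hj, rfl⟩
        · simp
        · have := mem_range.1 (hS hj)
          exact mem_range.2 (by omega)
      · intro r hr
        dsimp only
        split_ifs with h
        · omega
        · have := h1 (r - 1) (by omega)
          omega
      · intro r c hrc hc
        obtain ⟨c, rfl⟩ : ∃ c', c = c' + 1 := ⟨c - 1, by omega⟩
        cases r with
        | zero =>
          simp only [if_true, Nat.succ_ne_zero, if_false, Prec, hm0, hm1]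
          left
          simp
        | succ r =>
          have := h2 r c (by omega) (by omega)
          simpa only [Nat.succ_ne_zero, if_false, Prec, hm0, add_tsub_cancel_right,
            add_lt_add_iff_right] using this
      · intro r c hr hc
        cases r with
        | zero =>
          simp only [if_true, Cel, hm1]
          simp only [hf c (by omega), zero_le, true_and, true_or]
        | succ r =>
          cases c with
          | zero =>
            rw [hs]
            simp only [if_true, Cel, hm1]
            simp only [hf (r + 1) (by omega), zero_le, true_and, or_true]
          | succ c =>
            have := h3 r c (by omega) (by omega)
            rw [← hD', this]
            simp only [Nat.succ_ne_zero, if_false, Cel, hm0, add_tsub_cancel_right,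
              add_le_add_iff_right]
    · have hn : ∀ c, (m, c) ∉ D := by
        intro c hc
        exact h0 ((hs _ _).1 (hY m c m 0 hc le_rfl (by omega)))
      have hn' : ∀ c, (c, m) ∉ D := fun c hc => hn c ((hs _ _).1 hc)
      obtain ⟨S, hS, l, h1, h2, h3⟩ := ih D hY hs
        (by intro i j h
            have h4 := hb _ _ h
            have h5 : i ≠ m := by rintro rfl; exact hn j h
            have h6 : j ≠ m := by rintro rfl; exact hn' i h
            omega)
      have hm0 : ∀ i, i + 1 ∈ S.image (· + 1) ↔ i ∈ S := by
        intro i; simp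
      have hm1 : 0 ∉ S.image (· + 1) := by simp
      refine ⟨S.image (· + 1), ?_, fun r => if r = m then 0 else l r + 1, ?_, ?_, ?_⟩
      · intro i hi
        simp only [mem_image] at hi
        obtain ⟨j, hj, rfl⟩ := hi
        have := mem_range.1 (hS hj)
        exact mem_range.2 (by omega)
      · intro r hr
        dsimp only
        split_ifs with h
        · omega
        · have := h1 r (by omega)
          omega
      · intro r c hrc hc
        have hr : r ≠ m := by omega
        by_cases hcm : c = m
        · simp only [hcm, hr, if_true, if_false, Prec, hm0, hm1, IsEmpty.forall_iff, and_true]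
          by_cases h7 : l r ∈ S
          · exact Or.inl h7
          · exact Or.inr ⟨h7, not_false, by omega⟩
        · have := h2 r c (by omega) (by omega)
          simpa only [hr, hcm, if_false, Prec, hm0, add_lt_add_iff_right] using this
      · intro r c hr hc
        by_cases hrm : r = m
        · subst hrm
          refine iff_of_false (hn c) ?_
          simp only [if_true, Cel, hm1]
          intro h
          rcases h with h | h
          · exact h.2
          · have : (if c = r then 0 else l c + 1) = 0 := by omega
            rw [this] at h
            exact hm1 h.2
        · by_cases hcm : c = m
          · subst hcm
            refine iff_of_false (hn' r) ?_
            simp only [if_true, Cel, hm1, hrm, if_false]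
            intro h
            rcases h with h | h
            · omega
            · exact h.2
          · have := h3 r c (by omega) (by omega)
            rw [this]
            simp only [hrm, hcm, if_false, Cel, hm0, add_le_add_iff_right]

theorem shape_exists {m : ℕ} {D : Finset (ℕ × ℕ)} (hY : IsYoung D)
    (hs : ∀ i j, (i, j) ∈ D ↔ (j, i) ∈ D) (hb : ∀ i j, (i, j) ∈ D → i < m ∧ j < m) :
    ∃ S ⊆ range m, D = DD m S := by
  obtain ⟨S, hS, l, h1, h2, h3⟩ := shape_aux m D hY hs hb
  refine ⟨S, hS, ?_⟩
  have h4 : ∀ r < m, rho m S (l r) = r :=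
    mono_id (f := fun r => rho m S (l r)) (fun r hr => rho_lt (h1 r hr))
      (fun r c hrc hc => rho_lt_of (h1 r (by omega)) (h2 r c hrc hc))
  have h5 : ∀ r < m, ell m S r = l r := by
    intro r hr
    conv_lhs => rw [← h4 r hr]
    exact ell_rho (h1 r hr)
  ext ⟨r, c⟩
  rw [mem_DD]
  constructor
  · intro h
    have h6 := hb _ _ h
    refine ⟨h6.1, h6.2, ?_⟩
    rw [h5 r h6.1, h5 c h6.2]
    exact (h3 r c h6.1 h6.2).1 h
  · rintro ⟨hr, hc, h⟩
    rw [h5 r hr, h5 c hc] at h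
    exact (h3 r c hr hc).2 h

/-! ### The original tableaux -/

theorem Tab.card_eq {m : ℕ} {cell : ℕ → ℕ → Prop} {P : Finset (ℕ × ℕ)}
    (h : Tab (range m) (· < ·) cell P) : P.card + 1 = 2 * m := by
  classical
  set A := P.filter (fun c => ¬ ∃ k, k < c.2 ∧ (c.1, k) ∈ P) with hA
  set B := P.filter (fun c => ¬ ∃ r, r < c.1 ∧ (r, c.2) ∈ P) with hB
  have hAB : A.card = B.card := by
    refine card_nbij' Prod.swap Prod.swap ?_ ?_ ?_ ?_
    · rintro ⟨i, j⟩ hc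
      simp only [hA, hB, coe_filter, Set.mem_ofPred_eq, Prod.swap] at hc ⊢
      refine ⟨h.symm _ _ hc.1, ?_⟩
      rintro ⟨r, h1, h2⟩
      exact hc.2 ⟨r, h1, h.symm _ _ h2⟩
    · rintro ⟨i, j⟩ hc
      simp only [hA, hB, coe_filter, Set.mem_ofPred_eq, Prod.swap] at hc ⊢
      refine ⟨h.symm _ _ hc.1, ?_⟩
      rintro ⟨r, h1, h2⟩
      exact hc.2 ⟨r, h1, h.symm _ _ h2⟩
    · rintro ⟨i, j⟩ _; rfl
    · rintro ⟨i, j⟩ _; rfl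
  have hAm : A.card = m := by
    have e : A.image Prod.fst = range m := by
      ext i
      simp only [mem_image, Prod.exists, exists_and_right, exists_eq_right]
      constructor
      · rintro ⟨j, hj⟩
        exact (h.sub _ _ (mem_filter.1 hj).1).1
      · intro hi
        have hex := h.cov i hi
        refine ⟨Nat.find hex, mem_filter.2 ⟨Nat.find_spec hex, ?_⟩⟩
        rintro ⟨k, hk, hk'⟩
        exact Nat.find_min hex hk hk'
    have e2 : (A.image Prod.fst).card = A.card := by
      apply card_image_of_injOn
      rintro ⟨i, j⟩ h1 ⟨i', j'⟩ h2 (h3 : i = i')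
      subst h3
      simp only [hA, coe_filter, Set.mem_ofPred_eq] at h1 h2
      have h4 : ¬ j < j' := fun hl => h2.2 ⟨j, hl, h1.1⟩
      have h5 : ¬ j' < j := fun hl => h1.2 ⟨j', hl, h2.1⟩
      rw [show j = j' by omega]
    rw [← e2, e, card_range]
  have t := card_filter_add_card_filter_not (s := P) (fun c => ¬ ∃ k, k < c.2 ∧ (c.1, k) ∈ P)
  have hBe : P.filter (fun c => ¬ ¬ ∃ k, k < c.2 ∧ (c.1, k) ∈ P) = B.erase (0, 0) := by
    ext ⟨i, j⟩
    simp only [hB, mem_filter, mem_erase, ne_eq, Prod.mk.injEq]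
    by_cases h0 : i = 0 ∧ j = 0
    · obtain ⟨rfl, rfl⟩ := h0
      simp
    · constructor
      · rintro ⟨h1, h2⟩
        have := h.cond i j h1 h0
        exact ⟨h0, h1, by rw [this]; exact h2⟩
      · rintro ⟨_, h1, h2⟩
        have := h.cond i j h1 h0
        exact ⟨h1, by rw [this] at h2; exact h2⟩
  have hr : (0, 0) ∈ B := by
    simp [hB, h.root]
  have := card_erase_add_one hr
  have t2 : A.card + (B.erase (0, 0)).card = P.card := by
    rw [← hBe, hA]
    convert t
  omega

theorem tab_of_tlt {n : ℕ} {D P : Finset (ℕ × ℕ)} (h : IsTLT D P) (hs : IsSymmetric D P)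
    (hc : P.card = 2 * n + 1) :
    (∀ i j, (i, j) ∈ D → i < n + 1 ∧ j < n + 1) ∧
      Tab (range (n + 1)) (· < ·) (fun i j => (i, j) ∈ D) P := by
  obtain ⟨hY, hPD, hroot, hcond, hcov⟩ := h
  have hex : ∃ r, (r, 0) ∉ D := by
    by_contra hn
    push Not at hn
    have : Set.InjOn (fun r : ℕ => (r, 0)) (Set.univ : Set ℕ) := by
      intro a _ b _ hab
      simpa using hab
    have hinf : (Set.univ : Set ℕ).Infinite := Set.infinite_univ
    exact (hinf.image this) (D.finite_toSet.subset (by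
      rintro _ ⟨r, _, rfl⟩
      exact hn r))
  have hm : ∀ r, (r, 0) ∈ D ↔ r < Nat.find hex := by
    intro r
    constructor
    · intro hr
      by_contra hlt
      exact Nat.find_spec hex (hY r 0 _ 0 hr (by omega) le_rfl)
    · intro hr
      have := Nat.find_min hex hr
      push Not at this
      exact this
  set m := Nat.find hex
  have hb : ∀ i j, (i, j) ∈ D → i < m ∧ j < m := by
    intro i j hij
    refine ⟨(hm i).1 (hY _ _ _ _ hij le_rfl (by omega)), ?_⟩
    exact (hm j).1 (hY _ _ _ _ ((hs.1 _ _).1 hij) le_rfl (by omega))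
  have ht : Tab (range m) (· < ·) (fun i j => (i, j) ∈ D) P := by
    constructor
    · intro i j hij
      have h1 := hPD hij
      have h2 := hb _ _ h1
      exact ⟨mem_range.2 h2.1, mem_range.2 h2.2, h1⟩
    · intro i j hij
      exact (hs.2 i j).1 hij
    · exact hroot
    · intro i j hij hne
      exact hcond (i, j) hij (by simpa using hne)
    · intro i hi
      exact (hcov (i, 0) ((hm i).2 (mem_range.1 hi))).1
  have := ht.card_eq
  have hmn : m = n + 1 := by omega
  rw [hmn] at hb ht
  exact ⟨hb, ht⟩

theorem mem_SymTLTs {n : ℕ} {T : Finset (ℕ × ℕ) × Finset (ℕ × ℕ)} :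
    T ∈ SymTLTs n ↔ IsYoung T.1 ∧ (∀ i j, (i, j) ∈ T.1 ↔ (j, i) ∈ T.1) ∧
      (∀ i j, (i, j) ∈ T.1 → i < n + 1 ∧ j < n + 1) ∧
      Tab (range (n + 1)) (· < ·) (fun i j => (i, j) ∈ T.1) T.2 := by
  classical
  obtain ⟨D, P⟩ := T
  simp only [SymTLTs, mem_filter, mem_product, mem_powerset]
  constructor
  · rintro ⟨_, h1, h2, h3⟩
    have := tab_of_tlt h1 h2 h3
    exact ⟨h1.1, h2.1, this⟩
  · rintro ⟨hY, hs, hb, ht⟩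
    have hPD : P ⊆ D := by
      rintro ⟨i, j⟩ hij
      exact (ht.sub _ _ hij).2.2
    have hDD : D ⊆ range (2 * n + 2) ×ˢ range (2 * n + 2) := by
      rintro ⟨i, j⟩ hij
      have := hb _ _ hij
      simp only [mem_product, mem_range]
      omega
    refine ⟨⟨hDD, hPD.trans hDD⟩, ⟨hY, hPD, ht.root, ?_, ?_⟩, ⟨hs, ?_⟩, ?_⟩
    · rintro ⟨i, j⟩ hij hne
      exact ht.cond i j hij (by simpa using hne)
    · rintro ⟨i, j⟩ hij
      have := hb _ _ hij
      refine ⟨ht.cov i (mem_range.2 this.1), ?_⟩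
      obtain ⟨r, hr⟩ := ht.cov j (mem_range.2 this.2)
      exact ⟨r, ht.symm _ _ hr⟩
    · intro i j
      exact ⟨ht.symm i j, ht.symm j i⟩
    · have := ht.card_eq
      omega

/-- The map from the model to tableaux. -/
noncomputable def Phi (m : ℕ) (T : Finset ℕ × Finset (ℕ × ℕ)) :
    Finset (ℕ × ℕ) × Finset (ℕ × ℕ) :=
  (DD m T.1, pullP (range m) (ell m T.1) T.2)

theorem Phi_mem {n : ℕ} {T : Finset ℕ × Finset (ℕ × ℕ)} (hT : T ∈ XX (n + 1)) :
    Phi (n + 1) T ∈ SymTLTs n := by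
  have h := mem_XX.1 hT
  have h0 := zero_mem_of_XX hT
  rw [mem_SymTLTs]
  refine ⟨DD_young _ _, fun i j => DD_symm, ?_, ?_⟩
  · intro i j hij
    have := mem_DD.1 hij
    exact ⟨this.1, this.2.1⟩
  · refine h.2.pullP ell_mem rho_mem ?_ (by simp) ?_ ?_
    · have := ell_rho (m := n + 1) (S := T.1) (i := 0) (by omega)
      rwa [rho_zero h0] at this
    · intro i hi j hj
      exact (prec_ell (mem_range.1 hi) (mem_range.1 hj)).symm
    · intro i hi j hj hij
      exact mem_DD.2 ⟨mem_range.1 hi, mem_range.1 hj, (h.2.sub _ _ hij).2.2⟩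

theorem Phi_inj {n : ℕ} {T T' : Finset ℕ × Finset (ℕ × ℕ)} (hT : T ∈ XX (n + 1))
    (hT' : T' ∈ XX (n + 1)) (h : Phi (n + 1) T = Phi (n + 1) T') : T = T' := by
  obtain ⟨S, P⟩ := T
  obtain ⟨S', P'⟩ := T'
  rw [Phi, Phi, Prod.mk.injEq] at h
  have h1 := DD_inj (mem_XX.1 hT).1 (mem_XX.1 hT').1 h.1
  dsimp only at h1 h
  subst h1
  have h2 := congrArg (pullP (range (n + 1)) (rho (n + 1) S)) h.2
  rw [pullP_pullP (XX_mem hT) rho_mem, pullP_pullP (XX_mem hT') rho_mem] at h2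
  exact Prod.ext rfl h2

theorem Phi_surj {n : ℕ} {T : Finset (ℕ × ℕ) × Finset (ℕ × ℕ)} (hT : T ∈ SymTLTs n) :
    ∃ T' ∈ XX (n + 1), Phi (n + 1) T' = T := by
  obtain ⟨D, P⟩ := T
  obtain ⟨hY, hs, hb, ht⟩ := mem_SymTLTs.1 hT
  dsimp only at *
  obtain ⟨S, hS, rfl⟩ := shape_exists hY hs hb
  have h0 : 0 ∈ S := by
    have h1 := (ht.sub _ _ ht.root).2.2
    have h2 : ∀ r, r < n + 1 → (0, r) ∈ DD (n + 1) S := by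
      intro r hr
      obtain ⟨j, hj⟩ := ht.cov r (mem_range.2 hr)
      have h3 := (ht.sub _ _ hj).2.2
      exact hY _ _ _ _ (DD_symm.1 h3) (by omega) le_rfl
    have h3 := h2 (rho (n + 1) S 0) (rho_lt (by omega))
    rw [mem_DD, ell_rho (by omega)] at h3
    rcases h3.2.2 with h4 | h4
    · rw [show ell (n + 1) S 0 = 0 by omega] at h4
      exact h4.2
    · exact h4.2
  refine ⟨(S, pullP (range (n + 1)) (rho (n + 1) S) P), mem_XX.2 ⟨hS, ?_⟩, ?_⟩
  · refine ht.pullP rho_mem ell_mem (rho_zero h0) (by simp) ?_ ?_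
    · intro i hi j hj
      exact (rho_lt_iff (mem_range.1 hi) (mem_range.1 hj)).symm
    · intro i hi j hj hij
      have h1 := mem_DD.1 (ht.sub _ _ hij).2.2
      rw [ell_rho (mem_range.1 hi), ell_rho (mem_range.1 hj)] at h1
      exact h1.2.2
  · rw [Phi]
    ext1
    · rfl
    · exact pullP_pullP (fun i j hij => ⟨(ht.sub _ _ hij).1, (ht.sub _ _ hij).2.1⟩) ell_mem

/-- Corners in terms of labels. -/
def LCorner (n : ℕ) (S : Finset ℕ) (i j : ℕ) : Prop :=
  (j = i + 1 ∧ i ∈ S ∧ j ∉ S) ∨ (i = j + 1 ∧ j ∈ S ∧ i ∉ S) ∨ (i = n ∧ j = n ∧ n ∈ S)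

theorem lcorner_iff {n : ℕ} {S : Finset ℕ} {i j : ℕ} (hi : i < n + 1) (hj : j < n + 1) :
    (Cel S i j ∧ (∀ i' < n + 1, Prec S i i' → ¬ Cel S i' j) ∧
      (∀ j' < n + 1, Prec S j j' → ¬ Cel S i j')) ↔ LCorner n S i j := by
  constructor
  · rintro ⟨h1, h2, h3⟩
    have a1 := h2 j hj
    have a2 := h3 i hi
    have b1 := h2 n (by omega)
    have b2 := h3 n (by omega)
    have c1 := h2 (i + 1)
    have c2 := h3 (i + 1)
    have d1 := h2 (j + 1)
    have d2 := h3 (j + 1)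
    unfold LCorner
    unfold Cel Prec at *
    clear h2 h3
    rcases lt_trichotomy i j with h | h | h
    · left
      grind
    · right; right
      grind
    · right; left
      grind
  · rintro (⟨rfl, h1, h2⟩ | ⟨rfl, h1, h2⟩ | ⟨rfl, rfl, h1⟩)
    · refine ⟨Or.inl ⟨by omega, h1⟩, ?_, ?_⟩
      · intro i' hi' hp hc
        unfold Cel Prec at *
        grind
      · intro i' hi' hp hc
        unfold Cel Prec at *
        grind
    · refine ⟨Or.inr ⟨by omega, h1⟩, ?_, ?_⟩
      · intro i' hi' hp hc
        unfold Cel Prec at *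
        grind
      · intro i' hi' hp hc
        unfold Cel Prec at *
        grind
    · refine ⟨Or.inl ⟨le_rfl, h1⟩, ?_, ?_⟩
      · intro i' hi' hp hc
        unfold Cel Prec at *
        grind
      · intro i' hi' hp hc
        unfold Cel Prec at *
        grind

theorem next_iff {m : ℕ} {S : Finset ℕ} {i j : ℕ} (hi : i < m) (hj : j < m) :
    (rho m S i + 1, rho m S j) ∉ DD m S ↔ ∀ i' < m, Prec S i i' → ¬ Cel S i' j := by
  constructor
  · intro h i' hi' hp hc
    apply h
    have h1 := rho_lt_of (m := m) hi hp
    have h2 : (rho m S i', rho m S j) ∈ DD m S := by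
      rw [mem_DD, ell_rho hi', ell_rho hj]
      exact ⟨rho_lt hi', rho_lt hj, hc⟩
    exact cel_down' h2 h1
  · intro h hD
    rw [mem_DD, ell_rho hj] at hD
    have h1 := ell_spec (S := S) hD.1
    refine h _ h1.1 ?_ hD.2.2
    rw [← rho_lt_iff hi h1.1, h1.2]
    omega

theorem corner_iff {n : ℕ} {S : Finset ℕ} {i j : ℕ} (hi : i < n + 1) (hj : j < n + 1) :
    CornerCell (DD (n + 1) S) (rho (n + 1) S i, rho (n + 1) S j) ↔ LCorner n S i j := by
  rw [← lcorner_iff hi hj, CornerCell]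
  have h1 : (rho (n + 1) S i, rho (n + 1) S j) ∈ DD (n + 1) S ↔ Cel S i j := by
    rw [mem_DD, ell_rho hi, ell_rho hj]
    exact ⟨fun h => h.2.2, fun h => ⟨rho_lt hi, rho_lt hj, h⟩⟩
  have h2 := next_iff (S := S) hi hj
  have h3 := next_iff (S := S) hj hi
  rw [DD_symm] at h3
  rw [h1, h2, h3]
  simp only [cel_symm (j := i)]

open scoped Classical in
theorem noc_Phi {n : ℕ} (hn : 1 ≤ n) {T : Finset ℕ × Finset (ℕ × ℕ)} (hT : T ∈ XX (n + 1)) :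
    (nocCornersOf (Phi (n + 1) T).1 (Phi (n + 1) T).2).card =
      2 * ((range n).filter (fun k => k ∈ T.1 ∧ k + 1 ∉ T.1 ∧ (k, k + 1) ∉ T.2)).card +
        (if n ∈ T.1 then 1 else 0) := by
  obtain ⟨S, P⟩ := T
  have h := (mem_XX.1 hT).2
  dsimp only [Phi] at *
  set K := (range n).filter (fun k => k ∈ S ∧ k + 1 ∉ S ∧ (k, k + 1) ∉ P) with hK
  have hKm : ∀ k, k ∈ K ↔ k < n ∧ k ∈ S ∧ k + 1 ∉ S ∧ (k, k + 1) ∉ P := by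
    intro k; simp [hK]
  have e1 : (nocCornersOf (DD (n + 1) S) (pullP (range (n + 1)) (ell (n + 1) S) P)).card =
      ((range (n + 1) ×ˢ range (n + 1)).filter
        (fun c => LCorner n S c.1 c.2 ∧ c ∉ P)).card := by
    symm
    refine card_nbij' (fun c => (rho (n + 1) S c.1, rho (n + 1) S c.2))
      (fun c => (ell (n + 1) S c.1, ell (n + 1) S c.2)) ?_ ?_ ?_ ?_
    · rintro ⟨i, j⟩ hc
      simp only [nocCornersOf, coe_filter, Set.mem_ofPred_eq, mem_product, mem_range] at hc ⊢
      have hco := (corner_iff hc.1.1 hc.1.2).2 hc.2.1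
      refine ⟨hco.1, hco, ?_⟩
      rw [mem_pullP, ell_rho hc.1.1, ell_rho hc.1.2]
      tauto
    · rintro ⟨r, c⟩ hc
      simp only [nocCornersOf, coe_filter, Set.mem_ofPred_eq, mem_product, mem_range] at hc ⊢
      have hm := mem_DD.1 hc.1
      have h1 := ell_spec (S := S) hm.1
      have h2 := ell_spec (S := S) hm.2.1
      refine ⟨⟨h1.1, h2.1⟩, ?_, ?_⟩
      · rw [← corner_iff h1.1 h2.1, h1.2, h2.2]
        exact hc.2.1
      · intro hP
        apply hc.2.2
        rw [mem_pullP]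
        exact ⟨mem_range.2 hm.1, mem_range.2 hm.2.1, hP⟩
    · rintro ⟨i, j⟩ hc
      simp only [coe_filter, Set.mem_ofPred_eq, mem_product, mem_range] at hc
      dsimp only
      rw [ell_rho hc.1.1, ell_rho hc.1.2]
    · rintro ⟨r, c⟩ hc
      simp only [nocCornersOf, coe_filter, Set.mem_ofPred_eq] at hc
      have hm := mem_DD.1 hc.1
      dsimp only
      rw [(ell_spec hm.1).2, (ell_spec hm.2.1).2]
  have e2 : (range (n + 1) ×ˢ range (n + 1)).filter (fun c => LCorner n S c.1 c.2 ∧ c ∉ P) =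
      (K.image (fun k => (k, k + 1)) ∪ K.image (fun k => (k + 1, k))) ∪
        (if n ∈ S then {(n, n)} else ∅) := by
    ext ⟨i, j⟩
    have hd : (n, n) ∉ P := fun hP => by have := h.diag hP; omega
    have hs1 := h.symm i j
    have hs2 := h.symm j i
    have hite : (i, j) ∈ (if n ∈ S then {(n, n)} else ∅ : Finset (ℕ × ℕ)) ↔
        (i = n ∧ j = n ∧ n ∈ S) := by
      split_ifs with hnS
      · simp [hnS]
      · simp [hnS]
    rw [mem_filter, mem_product, mem_range, mem_range]
    simp only [mem_union, mem_image, hite, hKm, Prod.mk.injEq]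
    unfold LCorner
    constructor
    · rintro ⟨⟨hi, hj⟩, ⟨rfl, h1, h2⟩ | ⟨rfl, h1, h2⟩ | h1, hP⟩
      · exact Or.inl (Or.inl ⟨i, ⟨by omega, h1, h2, hP⟩, rfl, rfl⟩)
      · exact Or.inl (Or.inr ⟨j, ⟨by omega, h1, h2, by tauto⟩, rfl, rfl⟩)
      · exact Or.inr h1
    · rintro ((⟨k, ⟨h1, h2, h3, h4⟩, rfl, rfl⟩ | ⟨k, ⟨h1, h2, h3, h4⟩, rfl, rfl⟩) | ⟨rfl, rfl, h1⟩)
      · exact ⟨by omega, Or.inl ⟨rfl, h2, h3⟩, h4⟩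
      · exact ⟨by omega, Or.inr (Or.inl ⟨rfl, h2, h3⟩), by tauto⟩
      · exact ⟨by omega, Or.inr (Or.inr ⟨rfl, rfl, h1⟩), hd⟩
  rw [e1, e2, card_union_of_disjoint, card_union_of_disjoint, card_image_of_injective,
    card_image_of_injective]
  · split_ifs <;> simp <;> omega
  · intro a b hab
    simp only [Prod.mk.injEq] at hab
    exact hab.2
  · intro a b hab
    simp only [Prod.mk.injEq] at hab
    exact hab.1
  · rw [disjoint_left]
    rintro ⟨i, j⟩ h1 h2
    simp only [mem_image, Prod.mk.injEq] at h1 h2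
    obtain ⟨a, _, h3, h4⟩ := h1
    obtain ⟨b, _, h5, h6⟩ := h2
    omega
  · rw [disjoint_left]
    rintro ⟨i, j⟩ h1 h2
    simp only [mem_union, mem_image, Prod.mk.injEq] at h1
    have h7 : i = j := by
      split_ifs at h2
      · simp only [mem_singleton, Prod.mk.injEq] at h2
        omega
      · simp at h2
    rcases h1 with ⟨a, _, h3, h4⟩ | ⟨a, _, h3, h4⟩ <;> omega

open scoped Classical in
theorem total_noc (n : ℕ) (hn : 1 ≤ n) :
    ∑ T ∈ SymTLTs n, (nocCornersOf T.1 T.2).card =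
      2 * ∑ k ∈ range n, k * aa n k + aa (n + 1) n := by
  have e1 : ∑ T ∈ SymTLTs n, (nocCornersOf T.1 T.2).card =
      ∑ T ∈ XX (n + 1),
        (2 * ((range n).filter (fun k => k ∈ T.1 ∧ k + 1 ∉ T.1 ∧ (k, k + 1) ∉ T.2)).card +
        (if n ∈ T.1 then 1 else 0)) := by
    symm
    refine sum_bij (fun T _ => Phi (n + 1) T) (fun T hT => Phi_mem hT)
      (fun T hT T' hT' h => Phi_inj hT hT' h) ?_ ?_
    · intro T hT
      obtain ⟨T', h1, h2⟩ := Phi_surj hT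
      exact ⟨T', h1, h2⟩
    · intro T hT
      exact (noc_Phi hn hT).symm
  rw [e1, sum_add_distrib, ← mul_sum]
  congr 1
  · congr 1
    simp only [card_filter]
    rw [sum_comm]
    refine sum_congr rfl fun k hk => ?_
    rw [← noc_eq n k (mem_range.1 hk), card_filter]
  · rw [aa, card_filter]

open scoped Classical in
theorem stmt9 (n : ℕ) (hn : 2 ≤ n) :
    12 * ∑ T ∈ SymTLTs n, (nocCornersOf T.1 T.2).card
    = 2 ^ n * n.factorial * (4 * n + 13) - 12 * (2 ^ n * n.factorial) := by
  rw [total_noc n (by omega), final_count n hn, mul_comm 12 (2 ^ n * n.factorial), ← Nat.mul_sub]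
  congr 1
end

section
/- For 0 < r < n, the number of ascending runs of length exactly r in all permutations of [n] equals n!·[n(r(r+1)−1) − r(r−2)(r+2) + 1]/(r+2)!. -/
open Finset

/-- The word `σ₁ … σₙ` of a permutation of `[n]` (positions `1,…,n`), with the
boundary conventions `σ₀ = n+1` and `σ_{n+1} = 0`. -/
def rval (n : ℕ) (σ : Equiv.Perm (Fin n)) (t : ℕ) : ℕ :=
  if t = 0 then n + 1
  else if h : t - 1 < n then (σ ⟨t - 1, h⟩ : ℕ) + 1
  else 0

/-- The word `σ` is increasing on the `L` consecutive positions starting at `m`. -/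
def ascAt (n : ℕ) (σ : Equiv.Perm (Fin n)) (m L : ℕ) : Prop :=
  ∀ k < L - 1, rval n σ (m + k) < rval n σ (m + k + 1)

open scoped Classical in
/-- Number of permutations increasing on a window. -/
noncomputable def ascCount (n m L : ℕ) : ℤ :=
  ∑ σ : Equiv.Perm (Fin n), if ascAt n σ m L then 1 else 0

open scoped Classical in
lemma core_count {n L : ℕ} (f : Fin L ↪ Fin n) :
    L.factorial * (univ.filter (fun σ : Equiv.Perm (Fin n) =>
      StrictMono (fun i => σ (f i)))).card = n.factorial := by
  have h1 : ∀ τ : Equiv.Perm (Fin L),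
      (univ.filter (fun σ : Equiv.Perm (Fin n) => StrictMono (fun i => σ (f (τ i))))).card
      = (univ.filter (fun σ : Equiv.Perm (Fin n) => StrictMono (fun i => σ (f i)))).card := by
    intro τ
    apply Finset.card_equiv (Equiv.mulRight (τ.viaEmbedding f))
    intro σ
    simp [Equiv.Perm.viaEmbedding_apply]
  have h2 : ∀ σ : Equiv.Perm (Fin n),
      (univ.filter (fun τ : Equiv.Perm (Fin L) => StrictMono (fun i => σ (f (τ i))))).card = 1 := by
    intro σ
    have hinj : Function.Injective (fun i => σ (f i)) := σ.injective.comp f.injective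
    rw [Finset.card_eq_one]
    refine ⟨Tuple.sort (fun i => σ (f i)), ?_⟩
    ext τ
    simp only [mem_filter, mem_univ, true_and, mem_singleton]
    constructor
    · intro h
      have := Tuple.unique_monotone (f := fun i => σ (f i)) (σ := τ)
        (τ := Tuple.sort (fun i => σ (f i))) h.monotone (Tuple.monotone_sort _)
      ext i
      have h3 := congrFun this i
      exact congrArg Fin.val (hinj h3)
    · rintro rfl
      exact (Tuple.monotone_sort (fun i => σ (f i))).strictMono_of_injective
        (hinj.comp (Equiv.injective _))
  have h3 : ∑ τ : Equiv.Perm (Fin L),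
      (univ.filter (fun σ : Equiv.Perm (Fin n) => StrictMono (fun i => σ (f (τ i))))).card
      = ∑ σ : Equiv.Perm (Fin n),
      (univ.filter (fun τ : Equiv.Perm (Fin L) => StrictMono (fun i => σ (f (τ i))))).card := by
    simp only [Finset.card_filter]
    exact Finset.sum_comm
  simp only [h1, h2] at h3
  simpa [Fintype.card_perm] using h3

lemma rval_zero (n : ℕ) (σ : Equiv.Perm (Fin n)) : rval n σ 0 = n + 1 := by simp [rval]

lemma rval_succ (n : ℕ) (σ : Equiv.Perm (Fin n)) (t : ℕ) (h : t < n) :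
    rval n σ (t + 1) = (σ ⟨t, h⟩ : ℕ) + 1 := by simp [rval, h]

lemma rval_big (n : ℕ) (σ : Equiv.Perm (Fin n)) (t : ℕ) (h : n < t) : rval n σ t = 0 := by
  have h1 : t ≠ 0 := by omega
  have h2 : ¬ (t - 1 < n) := by omega
  simp [rval, h1, h2]

lemma rval_ne (n : ℕ) (σ : Equiv.Perm (Fin n)) (t : ℕ) (h : t ≤ n) :
    rval n σ t ≠ rval n σ (t + 1) := by
  rcases Nat.lt_or_ge t n with h1 | h1
  · rw [rval_succ n σ t h1]
    rcases t with _ | s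
    · rw [rval_zero]
      have := (σ ⟨0, h1⟩).isLt
      omega
    · rw [rval_succ n σ s (by omega)]
      intro h2
      have h3 : σ ⟨s, by omega⟩ = σ ⟨s + 1, h1⟩ := Fin.ext (by omega)
      have h4 := σ.injective h3
      simp at h4
  · rw [rval_big n σ (t + 1) (by omega)]
    rcases t with _ | s
    · rw [rval_zero]; omega
    · rw [rval_succ n σ s (by omega)]; omega

open scoped Classical in
lemma ascCount_main (n m L : ℕ) (h : m + L ≤ n) :
    (L.factorial : ℤ) * ascCount n (m + 1) L = n.factorial := by
  let f : Fin L ↪ Fin n :=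
    ⟨fun i => ⟨m + i, by omega⟩, fun i j hij => by
      have := congrArg Fin.val hij
      simp at this
      exact Fin.ext this⟩
  rw [← core_count f]
  unfold ascCount
  rw [Finset.sum_boole]
  push_cast
  congr 3
  ext σ
  simp only [mem_filter, mem_univ, true_and]
  rcases L with _ | L
  · constructor
    · intro _ i; exact i.elim0
    · intro _ k hk; omega
  · rw [Fin.strictMono_iff_lt_succ]
    constructor
    · intro ha i
      have := ha i (by have := i.isLt; omega)
      rw [show m + 1 + (i : ℕ) = (m + i) + 1 by omega,
        rval_succ n σ _ (by omega), rval_succ n σ (m + i + 1) (by omega)] at this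
      rw [Fin.lt_def]
      have h5 : f i.succ = ⟨m + i + 1, by omega⟩ := rfl
      have h6 : f i.castSucc = ⟨m + i, by omega⟩ := rfl
      rw [h5, h6]
      omega
    · intro ha k hk
      have := ha ⟨k, by omega⟩
      rw [show m + 1 + k = (m + k) + 1 by omega,
        rval_succ n σ _ (by omega), rval_succ n σ (m + k + 1) (by omega)]
      rw [Fin.lt_def] at this
      have h5 : f (Fin.succ ⟨k, by omega⟩) = ⟨m + k + 1, by omega⟩ :=
        rfl
      have h6 : f (Fin.castSucc ⟨k, by omega⟩) = ⟨m + k, by omega⟩ := rfl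
      rw [h5, h6] at this
      omega

lemma ascCount_zero (n L : ℕ) (hn : 0 < n) (hL : 2 ≤ L) : ascCount n 0 L = 0 := by
  unfold ascCount
  apply Finset.sum_eq_zero
  intro σ _
  rw [if_neg]
  intro h
  have := h 0 (by omega)
  rw [Nat.zero_add, rval_zero, rval_succ n σ 0 hn] at this
  have := (σ ⟨0, hn⟩).isLt
  omega

lemma ascCount_end (n m L : ℕ) (hL : 2 ≤ L) (h : n + 2 ≤ m + L) : ascCount n m L = 0 := by
  unfold ascCount
  apply Finset.sum_eq_zero
  intro σ _
  rw [if_neg]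
  intro h
  have := h (L - 2) (by omega)
  rw [rval_big n σ (m + (L - 2) + 1) (by omega)] at this
  omega

lemma ascAt_right (n : ℕ) (σ : Equiv.Perm (Fin n)) (m L : ℕ) :
    ascAt n σ m (L + 2) ↔ ascAt n σ m (L + 1) ∧ rval n σ (m + L) < rval n σ (m + L + 1) := by
  constructor
  · intro h
    exact ⟨fun k hk => h k (by omega), h L (by omega)⟩
  · rintro ⟨h1, h2⟩ k hk
    rcases Nat.lt_or_ge k L with h3 | h3
    · exact h1 k (by omega)
    · obtain rfl : k = L := by omega
      exact h2

lemma ascAt_left (n : ℕ) (σ : Equiv.Perm (Fin n)) (m L : ℕ) :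
    ascAt n σ m (L + 2) ↔ rval n σ m < rval n σ (m + 1) ∧ ascAt n σ (m + 1) (L + 1) := by
  constructor
  · intro h
    refine ⟨h 0 (by omega), fun k hk => ?_⟩
    have := h (k + 1) (by omega)
    rwa [show m + (k + 1) = m + 1 + k by omega] at this
  · rintro ⟨h1, h2⟩ k hk
    rcases k with _ | k
    · exact h1
    · have := h2 k (by omega)
      rwa [show m + 1 + k = m + (k + 1) by omega] at this

open scoped Classical in
lemma run_count (n m s : ℕ) (h : m + s + 1 ≤ n) :
    (∑ σ : Equiv.Perm (Fin n), if (rval n σ m > rval n σ (m + 1) ∧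
            ascAt n σ (m + 1) (s + 1) ∧
            rval n σ (m + 1 + s) > rval n σ (m + 1 + s + 1)) then (1 : ℤ) else 0)
    = ascCount n (m + 1) (s + 1) - ascCount n m (s + 2) - ascCount n (m + 1) (s + 2)
      + ascCount n m (s + 3) := by
  unfold ascCount
  rw [← Finset.sum_sub_distrib, ← Finset.sum_sub_distrib, ← Finset.sum_add_distrib]
  apply Finset.sum_congr rfl
  intro σ _
  have e1 := rval_ne n σ m (by omega)
  have e2 := rval_ne n σ (m + 1 + s) (by omega)
  have i1 : rval n σ m > rval n σ (m + 1) ↔ ¬ rval n σ m < rval n σ (m + 1) := by omega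
  have i2 : rval n σ (m + 1 + s) > rval n σ (m + 1 + s + 1) ↔
    ¬ rval n σ (m + 1 + s) < rval n σ (m + 1 + s + 1) := by omega
  simp only [i1, i2, ascAt_left n σ m (s + 1), ascAt_left n σ m s, ascAt_right n σ (m + 1) s]
  by_cases p : rval n σ m < rval n σ (m + 1) <;>
  by_cases q : rval n σ (m + 1 + s) < rval n σ (m + 1 + s + 1) <;>
  by_cases t : ascAt n σ (m + 1) (s + 1) <;> simp [p, q, t]

open scoped Classical in
theorem stmt11 (n r : ℕ) (hr : 0 < r) (hrn : r < n) :
    ((r + 2).factorial : ℤ) * ∑ σ : Equiv.Perm (Fin n),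
        (((Finset.Icc 1 n).filter
          (fun m => rval n σ (m - 1) > rval n σ m ∧
            (∀ k < r - 1, rval n σ (m + k) < rval n σ (m + k + 1)) ∧
            rval n σ (m + r - 1) > rval n σ (m + r))).card : ℤ)
    = (n.factorial : ℤ) *
        ((n : ℤ) * ((r : ℤ) * ((r : ℤ) + 1) - 1)
          - (r : ℤ) * ((r : ℤ) - 2) * ((r : ℤ) + 2) + 1) := by
  obtain ⟨s, rfl⟩ : ∃ s, r = s + 1 := ⟨r - 1, by omega⟩
  obtain ⟨e, rfl⟩ : ∃ e, n = e + 2 + s := ⟨n - s - 2, by omega⟩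
  set n := e + 2 + s with hn
  let F : ℕ → ℤ := fun m => ∑ σ : Equiv.Perm (Fin n), if (rval n σ m > rval n σ (m + 1) ∧
            ascAt n σ (m + 1) (s + 1) ∧
            rval n σ (m + 1 + s) > rval n σ (m + 1 + s + 1)) then (1 : ℤ) else 0
  have hsum : ∑ σ : Equiv.Perm (Fin n),
        (((Finset.Icc 1 n).filter
          (fun m => rval n σ (m - 1) > rval n σ m ∧
            (∀ k < s + 1 - 1, rval n σ (m + k) < rval n σ (m + k + 1)) ∧
            rval n σ (m + (s + 1) - 1) > rval n σ (m + (s + 1)))).card : ℤ)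
      = ∑ m ∈ range n, F m := by
    simp only [F]
    rw [Finset.sum_comm]
    apply Finset.sum_congr rfl
    intro σ _
    rw [Finset.card_filter, ← Finset.Ico_add_one_right_eq_Icc, Finset.sum_Ico_eq_sum_range]
    push_cast
    apply Finset.sum_congr (by simp)
    intro m _
    rw [add_comm 1 m]
    exact if_congr Iff.rfl rfl rfl
  have hzero : ∀ m, e + 2 ≤ m → F m = 0 := by
    intro m hm
    apply Finset.sum_eq_zero
    intro σ _
    rw [if_neg]
    rintro ⟨_, _, h⟩
    rw [rval_big n σ (m + 1 + s) (by omega)] at h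
    omega
  rw [hsum, hn, Finset.sum_range_add, Finset.sum_eq_zero (s := range s)
    (fun x _ => hzero _ (by omega)), add_zero, Finset.sum_range_succ, Finset.sum_range_succ']
  have f1 : ((s + 1 + 2).factorial : ℤ) = (s + 3) * (s + 2) * (s + 1).factorial := by
    rw [Nat.factorial_succ, Nat.factorial_succ]; push_cast; ring
  have f2 : ((s + 1 + 2).factorial : ℤ) = (s + 3) * (s + 2).factorial := by
    rw [Nat.factorial_succ]; push_cast; ring
  have g1 : ∀ m, m ≤ e + 1 →
      ((s + 1 + 2).factorial : ℤ) * ascCount n (m + 1) (s + 1)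
        = (s + 3) * (s + 2) * n.factorial := by
    intro m hm
    rw [f1, ← ascCount_main n m (s + 1) (by omega)]; ring
  have g2 : ∀ m, m ≤ e →
      ((s + 1 + 2).factorial : ℤ) * ascCount n (m + 1) (s + 2) = (s + 3) * n.factorial := by
    intro m hm
    rw [f2, ← ascCount_main n m (s + 2) (by omega)]; ring
  have F0 : ((s + 1 + 2).factorial : ℤ) * F 0 = n.factorial * ((s + 3) * (s + 1)) := by
    simp only [F]
    rw [run_count n 0 s (by omega), ascCount_zero n _ (by omega) (by omega),
      ascCount_zero n _ (by omega) (by omega)]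
    linear_combination g1 0 (by omega) - g2 0 (by omega)
  have Fe : ((s + 1 + 2).factorial : ℤ) * F (e + 1) = n.factorial * ((s + 3) * (s + 1)) := by
    simp only [F]
    rw [run_count n (e + 1) s (by omega), ascCount_end n (e + 1 + 1) (s + 2) (by omega) (by omega),
      ascCount_end n (e + 1) (s + 3) (by omega) (by omega)]
    linear_combination g1 (e + 1) (by omega) - g2 e (by omega)
  have Fm : ∀ m ∈ range e, ((s + 1 + 2).factorial : ℤ) * F (m + 1)
      = n.factorial * ((s + 3) * (s + 2) - 2 * (s + 3) + 1) := by
    intro m hm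
    rw [Finset.mem_range] at hm
    simp only [F]
    rw [run_count n (m + 1) s (by omega)]
    have g3 := ascCount_main n m (s + 3) (by omega)
    linear_combination g1 (m + 1) (by omega) - g2 m (by omega) - g2 (m + 1) (by omega) + g3
  rw [mul_add, mul_add, F0, Fe, Finset.mul_sum, Finset.sum_congr rfl Fm]
  rw [Finset.sum_const, Finset.card_range, nsmul_eq_mul]
  rw [← hn]
  have : (n : ℤ) = e + 2 + s := by rw [hn]; push_cast; ring
  rw [this]
  push_cast
  ring
end
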